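/- arXiv:2205.11596 — 2 statements merged into one kernel-verified Lean document; each statement's English description precedes it below -/
import Mathlib

section
/- Let p ≥ 0 be an integer, 0 < n* < 1, ε > 0 with n*−ε > 0, and let κ : (n*−ε, n*+ε) → ℂ be a continuous ITE trajectory (F_p(κ(n), n) = 0 for all n) that is differentiable at every n ≠ n*. Suppose κ(n*) = κ* > 0 with J_p(κ*) = 0 and J_p'(κ*) ≠ 0, and that J_p(κ(n)) ≠ 0 and J_p(√n·κ(n)) ≠ 0 for every n ≠ n*. Then the one-sided limits lim_{n↗n*} arg(κ'(n)) and lim_{n↘n*} arg(κ'(n)) exist and each belongs to the set {−2π/3, 0, 2π/3}; moreover, a one-sided limit equals 0 if and only if κ(n) is real for all n on the corresponding side of n* sufficiently close to n* (in particular, if Im κ(n) ≠ 0 for n ≠ n*, then both one-sided limits lie in {−2π/3, 2π/3}). -/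
open Complex Real Filter Set

/-- Bessel function of the first kind of integer order `p`. -/
noncomputable def besselJ (p : ℕ) (z : ℂ) : ℂ :=
  ∑' m : ℕ, ((-1 : ℂ) ^ m / ((Nat.factorial m : ℂ) * (Nat.factorial (m + p) : ℂ)))
    * (z / 2) ^ (2 * m + p)

/-- Derivative of the Bessel function. -/
noncomputable def besselJ' (p : ℕ) (z : ℂ) : ℂ := deriv (besselJ p) z

/-- The ITE determinant function `F_p(κ, n)`. -/
noncomputable def Fp (p : ℕ) (κ : ℂ) (n : ℝ) : ℂ :=
  κ * (besselJ' p κ * besselJ p ((Real.sqrt n : ℂ) * κ)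
    - (Real.sqrt n : ℂ) * besselJ p κ * besselJ' p ((Real.sqrt n : ℂ) * κ))


/-- The Bessel series with its `m`-th term weighted by `(2m+p)^k`, that is `(z d/dz)^k J_p(z)`. -/
noncomputable def besselEuler (p k : ℕ) (z : ℂ) : ℂ :=
  ∑' m : ℕ, ((2 * m + p : ℕ) : ℂ) ^ k *
    (((-1 : ℂ) ^ m / ((Nat.factorial m : ℂ) * (Nat.factorial (m + p) : ℂ)))
      * (z / 2) ^ (2 * m + p))

theorem besselEuler_zero (p : ℕ) : besselEuler p 0 = besselJ p := by
  funext z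
  simp [besselEuler, besselJ]

theorem norm_besselEuler_term_le (p k m : ℕ) {R : ℝ} {z : ℂ} (hz : ‖z‖ ≤ R) :
    ‖((2 * m + p : ℕ) : ℂ) ^ k *
      (((-1 : ℂ) ^ m / ((Nat.factorial m : ℂ) * (Nat.factorial (m + p) : ℂ)))
        * (z / 2) ^ (2 * m + p))‖ ≤
      (Nat.factorial k : ℝ) * (Real.exp 1 * R) ^ p *
        (((Real.exp 1 * R) ^ 2) ^ m / Nat.factorial m) := by
  have hR : 0 ≤ R := (norm_nonneg z).trans hz
  have h1 : ((2 * m + p : ℕ) : ℝ) ^ k ≤ Nat.factorial k * Real.exp 1 ^ (2 * m + p) := by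
    have h := Real.pow_div_factorial_le_exp (x := ((2 * m + p : ℕ) : ℝ)) (Nat.cast_nonneg _) k
    rw [div_le_iff₀ (by positivity)] at h
    rw [← Real.exp_nat_mul, mul_one]
    linarith
  have h2 : (‖z‖ / 2) ^ (2 * m + p) ≤ R ^ (2 * m + p) := by
    refine pow_le_pow_left₀ (by positivity) ?_ _
    linarith [norm_nonneg z]
  have h3 : (1 : ℝ) / (Nat.factorial m * Nat.factorial (m + p)) ≤ 1 / Nat.factorial m := by
    refine one_div_le_one_div_of_le (by positivity) ?_
    refine le_mul_of_one_le_right (by positivity) ?_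
    exact_mod_cast Nat.one_le_iff_ne_zero.2 (Nat.factorial_ne_zero _)
  calc _ = ((2 * m + p : ℕ) : ℝ) ^ k * ((1 / (Nat.factorial m * Nat.factorial (m + p)))
        * (‖z‖ / 2) ^ (2 * m + p)) := by
        simp only [norm_mul, norm_pow, norm_div, norm_neg, norm_one, one_pow,
          Complex.norm_natCast, Complex.norm_ofNat]
    _ ≤ (Nat.factorial k * Real.exp 1 ^ (2 * m + p)) *
        ((1 / Nat.factorial m) * R ^ (2 * m + p)) := by gcongr
    _ = _ := by
        simp only [mul_pow, pow_add, pow_mul]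
        ring

theorem summable_besselEuler_bound (p k : ℕ) (R : ℝ) :
    Summable fun m : ℕ => (Nat.factorial k : ℝ) * (Real.exp 1 * R) ^ p *
        (((Real.exp 1 * R) ^ 2) ^ m / Nat.factorial m) :=
  (Real.summable_pow_div_factorial _).mul_left _

theorem summable_besselEuler (p k : ℕ) (z : ℂ) :
    Summable fun m : ℕ => ((2 * m + p : ℕ) : ℂ) ^ k *
      (((-1 : ℂ) ^ m / ((Nat.factorial m : ℂ) * (Nat.factorial (m + p) : ℂ)))
        * (z / 2) ^ (2 * m + p)) :=
  .of_norm_bounded (summable_besselEuler_bound p k ‖z‖)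
    fun m => norm_besselEuler_term_le p k m le_rfl

theorem differentiable_besselEuler (p k : ℕ) : Differentiable ℂ (besselEuler p k) := by
  intro z
  have h := Complex.differentiableOn_tsum_of_summable_norm
    (F := fun (m : ℕ) (w : ℂ) => ((2 * m + p : ℕ) : ℂ) ^ k *
      (((-1 : ℂ) ^ m / ((Nat.factorial m : ℂ) * (Nat.factorial (m + p) : ℂ)))
        * (w / 2) ^ (2 * m + p)))
    (summable_besselEuler_bound p k (‖z‖ + 1)) (U := Metric.ball 0 (‖z‖ + 1))
    (fun m => by fun_prop) Metric.isOpen_ball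
    (fun m w hw => norm_besselEuler_term_le p k m (mem_ball_zero_iff.1 hw).le)
  exact h.differentiableAt (Metric.isOpen_ball.mem_nhds (by simp))

theorem mul_deriv_besselEuler (p k : ℕ) (z : ℂ) :
    z * deriv (besselEuler p k) z = besselEuler p (k + 1) z := by
  have h := Complex.hasSum_deriv_of_summable_norm
    (F := fun (m : ℕ) (w : ℂ) => ((2 * m + p : ℕ) : ℂ) ^ k *
      (((-1 : ℂ) ^ m / ((Nat.factorial m : ℂ) * (Nat.factorial (m + p) : ℂ)))
        * (w / 2) ^ (2 * m + p)))
    (summable_besselEuler_bound p k (‖z‖ + 1)) (U := Metric.ball 0 (‖z‖ + 1))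
    (fun m => by fun_prop) Metric.isOpen_ball
    (fun m w hw => norm_besselEuler_term_le p k m (mem_ball_zero_iff.1 hw).le)
    (z := z) (by simp)
  refine (h.mul_left z).unique ?_
  convert! (summable_besselEuler p (k + 1) z).hasSum using 2 with m
  have h1 : HasDerivAt (fun w : ℂ => ((2 * m + p : ℕ) : ℂ) ^ k *
      (((-1 : ℂ) ^ m / ((Nat.factorial m : ℂ) * (Nat.factorial (m + p) : ℂ)))
        * (w / 2) ^ (2 * m + p))) _ z :=
    ((((hasDerivAt_id z).div_const 2).pow (2 * m + p)).const_mul _).const_mul _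
  rw [h1.deriv]
  rcases Nat.eq_zero_or_pos (2 * m + p) with h0 | h0
  · simp [h0]
  · obtain ⟨j, hj⟩ := Nat.exists_eq_succ_of_ne_zero h0.ne'
    rw [hj]
    simp only [Nat.succ_eq_add_one, Nat.add_sub_cancel, id]
    ring

theorem besselEuler_two (p : ℕ) (z : ℂ) :
    besselEuler p 2 z = ((p : ℂ) ^ 2 - z ^ 2) * besselEuler p 0 z := by
  have h0 := (summable_besselEuler p 0 z).hasSum
  have h2 := (summable_besselEuler p 2 z).hasSum
  have h3 := h2.sub (h0.mul_left ((p : ℂ) ^ 2))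
  have h4 := h0.mul_left (-z ^ 2)
  have key : besselEuler p 2 z - (p : ℂ) ^ 2 * besselEuler p 0 z =
      -z ^ 2 * besselEuler p 0 z := by
    rw [← hasSum_nat_add_iff' 1] at h3
    refine (h3.unique ?_ |> fun h => by simpa [besselEuler] using h)
    convert! h4 using 1
    · funext m
      have e1 : (Nat.factorial (m + 1) : ℂ) = (m + 1) * Nat.factorial m := by
        push_cast [Nat.factorial_succ]; ring
      have e2 : (Nat.factorial (m + 1 + p) : ℂ) = (m + p + 1) * Nat.factorial (m + p) := by
        rw [show m + 1 + p = (m + p) + 1 by ring]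
        push_cast [Nat.factorial_succ]; ring
      have n1 : (m : ℂ) + 1 ≠ 0 := by exact_mod_cast Nat.succ_ne_zero m
      have n2 : (m : ℂ) + p + 1 ≠ 0 := by exact_mod_cast Nat.succ_ne_zero (m + p)
      have n3 : (Nat.factorial m : ℂ) ≠ 0 := by exact_mod_cast Nat.factorial_ne_zero m
      have n4 : (Nat.factorial (m + p) : ℂ) ≠ 0 := by
        exact_mod_cast Nat.factorial_ne_zero (m + p)
      rw [e1, e2, show 2 * (m + 1) + p = (2 * m + p) + 2 by ring, pow_succ (-1 : ℂ),
        pow_add _ (2 * m + p) 2]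
      push_cast
      field_simp
      ring
    · simp
  linear_combination key

theorem besselEuler_conj (p k : ℕ) (z : ℂ) :
    besselEuler p k (starRingEnd ℂ z) = starRingEnd ℂ (besselEuler p k z) := by
  simp [besselEuler, Complex.conj_tsum, map_ofNat]

theorem hasDerivAt_besselEuler (p k : ℕ) {z : ℂ} (hz : z ≠ 0) :
    HasDerivAt (besselEuler p k) (besselEuler p (k + 1) z / z) z := by
  rw [← mul_deriv_besselEuler, mul_div_cancel_left₀ _ hz]
  exact (differentiable_besselEuler p k z).hasDerivAt

theorem mul_besselJ' (p : ℕ) (z : ℂ) : z * besselJ' p z = besselEuler p 1 z := by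
  rw [besselJ', ← besselEuler_zero, mul_deriv_besselEuler]

/-- A nonzero common zero of `J_p` and `J_p'` forces `J_p = 0`. -/
theorem besselEuler_zero_eq_zero_of_common_zero (p : ℕ) {k : ℂ} (hk : k ≠ 0)
    (h0 : besselEuler p 0 k = 0) (h1 : besselEuler p 1 k = 0) (z : ℂ) :
    besselEuler p 0 z = 0 := by
  have an (j : ℕ) (w : ℂ) : AnalyticAt ℂ (besselEuler p j) w :=
    (differentiable_besselEuler p j).analyticAt w
  have hida : AnalyticAt ℂ (fun w : ℂ => w) k := by fun_prop
  have hid : analyticOrderAt (fun w : ℂ => w) k = 0 := hida.analyticOrderAt_eq_zero.2 hk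
  have hord (j : ℕ) : analyticOrderAt (besselEuler p (j + 1)) k =
      analyticOrderAt (deriv (besselEuler p j)) k := by
    have : besselEuler p (j + 1) = (fun w : ℂ => w) * deriv (besselEuler p j) := by
      funext w; exact (mul_deriv_besselEuler p j w).symm
    rw [this, analyticOrderAt_mul hida (an j k).deriv, hid, zero_add]
  have e0 := (an 0 k).analyticOrderAt_deriv_add_one
  have e1 := (an 1 k).analyticOrderAt_deriv_add_one
  simp only [h0, h1, sub_zero] at e0 e1
  rw [← hord] at e0 e1
  have e2 : analyticOrderAt (besselEuler p 0) k ≤ analyticOrderAt (besselEuler p 2) k := by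
    have : besselEuler p 2 = (fun w : ℂ => (p : ℂ) ^ 2 - w ^ 2) * besselEuler p 0 := by
      funext w; exact besselEuler_two p w
    rw [this, analyticOrderAt_mul (by fun_prop) (an 0 k)]
    exact le_add_self
  have htop : analyticOrderAt (besselEuler p 0) k = ⊤ := by
    change analyticOrderAt (besselEuler p 1) k + 1 = analyticOrderAt (besselEuler p 0) k at e0
    change analyticOrderAt (besselEuler p 2) k + 1 = analyticOrderAt (besselEuler p 1) k at e1
    rw [← e0, ← e1] at e2
    rw [← e0, ← e1]
    generalize analyticOrderAt (besselEuler p 2) k = a at e2 ⊢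
    cases a with
    | top => rfl
    | coe a => exfalso; norm_cast at e2; omega
  exact congrFun (AnalyticOnNhd.eq_of_eventuallyEq (f := besselEuler p 0) (g := 0)
    (fun w _ => an 0 w) (fun w _ => analyticAt_const) (analyticOrderAt_eq_top.1 htop)) z

/-- Cubing, as an order isomorphism of the real line. -/
noncomputable def realCube : ℝ ≃o ℝ :=
  StrictMono.orderIsoOfSurjective (fun x : ℝ => x ^ 3) (Odd.strictMono_pow (by decide)) (by
    intro y
    have hpos (x : ℝ) (hx : 0 ≤ x) : (x ^ (1 / 3 : ℝ)) ^ 3 = x := by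
      rw [← Real.rpow_natCast, ← Real.rpow_mul hx]; norm_num
    rcases le_total 0 y with hy | hy
    · exact ⟨y ^ (1 / 3 : ℝ), hpos y hy⟩
    · refine ⟨-(-y) ^ (1 / 3 : ℝ), ?_⟩
      have := hpos (-y) (by linarith)
      simp only [Odd.neg_pow (show Odd 3 by decide), this, neg_neg])

/-- The real cube root, as an order isomorphism of the real line. -/
noncomputable def realCubeRoot : ℝ ≃o ℝ := realCube.symm

theorem realCubeRoot_pow (x : ℝ) : realCubeRoot x ^ 3 = x :=
  realCube.apply_symm_apply x

theorem realCubeRoot_zero : realCubeRoot 0 = 0 :=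
  pow_eq_zero_iff (by norm_num : (3 : ℕ) ≠ 0) |>.1 (realCubeRoot_pow 0)

theorem realCubeRoot_ne_zero {x : ℝ} (hx : x ≠ 0) : realCubeRoot x ≠ 0 := fun h =>
  hx (by rw [← realCubeRoot_pow x, h]; norm_num)

theorem realCubeRoot_pos {x : ℝ} (hx : 0 < x) : 0 < realCubeRoot x := by
  rw [← realCubeRoot_zero]; exact realCubeRoot.strictMono hx

/-- A continuous function whose cube tends to `1` along connected sets tends to a cube root of
unity. -/
theorem exists_tendsto_of_tendsto_cube {l : Filter ℝ} [l.NeBot]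
    (hl : ∀ s ∈ l, ∃ t ∈ l, t ⊆ s ∧ IsOpen t ∧ IsPreconnected t) {g : ℝ → ℂ}
    (hg : ∀ᶠ n in l, ContinuousAt g n) (h : Tendsto (fun n => g n ^ 3) l (nhds 1)) :
    ∃ ω : ℂ, ω ^ 3 = 1 ∧ Tendsto g l (nhds ω) := by
  have hslit : ∀ᶠ n in l, g n ^ 3 ∈ Complex.slitPlane :=
    h.eventually (Complex.isOpen_slitPlane.mem_nhds Complex.one_mem_slitPlane)
  obtain ⟨t, ht, hts, -, htc⟩ := hl _ (hg.and hslit)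
  let r : ℝ → ℂ := fun n => (g n ^ 3) ^ (1 / 3 : ℂ)
  have hr3 (n : ℝ) : r n ^ 3 = g n ^ 3 := by
    simp [r]
  have hr0 {n : ℝ} (hn : n ∈ t) : r n ≠ 0 := fun h0 => by
    have := hr3 n
    rw [h0] at this
    exact Complex.slitPlane_ne_zero (hts hn).2 (by rw [← this]; norm_num)
  have hcont : ContinuousOn (fun n => g n / r n) t := by
    intro n hn
    refine ContinuousAt.continuousWithinAt ?_
    refine (hts hn).1.div ?_ (hr0 hn)
    exact ((hts hn).1.pow 3).cpow continuousAt_const (hts hn).2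
  have hfin : {z : ℂ | z ^ 3 = 1}.Finite := by
    have := (Polynomial.nthRoots 3 (1 : ℂ)).toFinset.finite_toSet
    refine this.subset fun z hz => ?_
    simpa [Polynomial.mem_nthRoots] using hz
  have hmaps : MapsTo (fun n => g n / r n) t {z : ℂ | z ^ 3 = 1} := by
    intro n hn
    change (g n / r n) ^ 3 = 1
    rw [div_pow, ← hr3 n, div_self (pow_ne_zero 3 (hr0 hn))]
  obtain ⟨a, ha⟩ := Filter.nonempty_of_mem ht
  refine ⟨g a / r a, hmaps ha, ?_⟩
  have hr : Tendsto r l (nhds 1) := by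
    have := h.cpow (tendsto_const_nhds (x := (1 / 3 : ℂ))) Complex.one_mem_slitPlane
    simpa [r] using this
  have h2 : Tendsto (fun n => g a / r a * r n) l (nhds (g a / r a)) := by
    simpa using hr.const_mul (g a / r a)
  refine h2.congr' ?_
  filter_upwards [ht] with n hn
  have e := htc.constant_of_mapsTo hfin.isDiscrete hcont hmaps ha hn
  rw [e, div_mul_cancel₀ _ (hr0 hn)]

theorem norm_eq_one_of_cube {ω : ℂ} (hω : ω ^ 3 = 1) : ‖ω‖ = 1 :=
  Complex.norm_eq_one_of_pow_eq_one hω (by norm_num)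

theorem eq_one_of_cube_of_arg_eq_zero {ω : ℂ} (hω : ω ^ 3 = 1) (h : Complex.arg ω = 0) :
    ω = 1 := by
  have := Complex.norm_mul_exp_arg_mul_I ω
  rw [norm_eq_one_of_cube hω, h] at this
  simpa using this.symm

theorem arg_mem_of_cube {ω : ℂ} (hω : ω ^ 3 = 1) :
    Complex.arg ω ∈ ({-(2 * Real.pi / 3), 0, 2 * Real.pi / 3} : Set ℝ) := by
  have h1 := Complex.norm_mul_exp_arg_mul_I ω
  rw [norm_eq_one_of_cube hω, Complex.ofReal_one, one_mul] at h1
  rw [← h1, ← Complex.exp_nat_mul, Complex.exp_eq_one_iff] at hω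
  obtain ⟨j, hj⟩ := hω
  have hj' : 3 * Complex.arg ω = j * (2 * Real.pi) := by
    have : ((3 * Complex.arg ω : ℝ) : ℂ) = ((j * (2 * Real.pi) : ℝ) : ℂ) := by
      refine mul_right_cancel₀ Complex.I_ne_zero ?_
      push_cast at hj ⊢
      linear_combination hj
    exact_mod_cast this
  have hlo := Complex.neg_pi_lt_arg ω
  have hhi := Complex.arg_le_pi ω
  have hpi := Real.pi_pos
  have hj1 : j < 2 := by
    by_contra! hc
    have : (2 : ℝ) ≤ j := by exact_mod_cast hc
    nlinarith
  have hj2 : -2 < j := by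
    by_contra! hc
    have : (j : ℝ) ≤ -2 := by exact_mod_cast hc
    nlinarith
  simp only [Set.mem_insert_iff, Set.mem_singleton_iff]
  interval_cases j
  · left; push_cast at hj'; linarith
  · right; left; push_cast at hj'; linarith
  · right; right; push_cast at hj'; linarith

theorem mem_slitPlane_of_cube {ω : ℂ} (hω : ω ^ 3 = 1) : ω ∈ Complex.slitPlane := by
  refine Complex.mem_slitPlane_iff_arg.2 ⟨fun h => ?_, fun h => by simp [h] at hω⟩
  have hpi := Real.pi_pos
  have := arg_mem_of_cube hω
  simp only [Set.mem_insert_iff, Set.mem_singleton_iff, h] at this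
  rcases this with h | h | h <;> linarith

/-- The first order behaviour of `h ∘ u` at a zero of `h`, relative to a scale `s`. -/
theorem tendsto_comp_div_of_hasDerivAt {l : Filter ℝ} {h : ℂ → ℂ} {d k v : ℂ}
    (hd : HasDerivAt h d k) (h0 : h k = 0) {u s : ℝ → ℂ} (hu : Tendsto u l (nhds k))
    (hs : Tendsto (fun n => (u n - k) / s n) l (nhds v)) :
    Tendsto (fun n => h (u n) / s n) l (nhds (d * v)) := by
  have hc : ContinuousAt (dslope h k) k := continuousAt_dslope_same.2 hd.differentiableAt
  have h1 := (hc.tendsto.comp hu).mul hs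
  rw [dslope_same, hd.deriv] at h1
  refine h1.congr fun n => ?_
  have := sub_smul_dslope h k (u n)
  rw [h0, sub_zero, smul_eq_mul] at this
  rw [← this, Function.comp_apply]
  ring

/-- A trajectory `κ` solving `h (κ n) = h (√n κ n)` through a common zero `k₀`, `√n₀ k₀` of a
solution `h` of the Riccati equation `z h' = 1 + (z² - q) h²`. -/
structure RiccatiTrajectory (h : ℂ → ℂ) (q : ℂ) (k₀ n₀ : ℝ) (κ : ℝ → ℂ) : Prop where
  k₀_pos : 0 < k₀
  n₀_pos : 0 < n₀
  n₀_lt_one : n₀ < 1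
  hasDerivAt : ∀ᶠ z in nhds (k₀ : ℂ), HasDerivAt h ((1 + (z ^ 2 - q) * h z ^ 2) / z) z
  hasDerivAt_sqrt : ∀ᶠ z in nhds ((Real.sqrt n₀ : ℂ) * (k₀ : ℂ)),
    HasDerivAt h ((1 + (z ^ 2 - q) * h z ^ 2) / z) z
  map_k₀ : h k₀ = 0
  map_sqrt : h ((Real.sqrt n₀ : ℂ) * (k₀ : ℂ)) = 0
  map_conj : ∀ z, h (starRingEnd ℂ z) = starRingEnd ℂ (h z)
  continuousAt : ContinuousAt κ n₀
  apply_n₀ : κ n₀ = k₀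
  differentiableAt : ∀ᶠ n in nhdsWithin n₀ {n₀}ᶜ, DifferentiableAt ℝ κ n
  eq_map : ∀ᶠ n in nhdsWithin n₀ {n₀}ᶜ, h (κ n) = h ((Real.sqrt n : ℂ) * κ n)
  map_ne_zero : ∀ᶠ n in nhdsWithin n₀ {n₀}ᶜ, h (κ n) ≠ 0

namespace RiccatiTrajectory

variable {h : ℂ → ℂ} {q : ℂ} {k₀ n₀ : ℝ} {κ : ℝ → ℂ}

theorem tendsto (T : RiccatiTrajectory h q k₀ n₀ κ) : Tendsto κ (nhds n₀) (nhds (k₀ : ℂ)) := by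
  simpa [T.apply_n₀] using T.continuousAt.tendsto

theorem tendsto_sqrt (n₀ : ℝ) :
    Tendsto (fun n : ℝ => (Real.sqrt n : ℂ)) (nhds n₀) (nhds (Real.sqrt n₀ : ℂ)) :=
  (Complex.continuous_ofReal.comp Real.continuous_sqrt).tendsto n₀

theorem tendsto_map (T : RiccatiTrajectory h q k₀ n₀ κ) :
    Tendsto (fun n => h (κ n)) (nhds n₀) (nhds 0) := by
  have := T.hasDerivAt.self_of_nhds.continuousAt.tendsto.comp T.tendsto
  rwa [T.map_k₀] at this

theorem deriv_eq (T : RiccatiTrajectory h q k₀ n₀ κ) : ∀ᶠ n in nhdsWithin n₀ {n₀}ᶜ,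
    deriv κ n = (1 + (n * κ n ^ 2 - q) * h (κ n) ^ 2) / (2 * n * κ n * (1 - n) * h (κ n) ^ 2) := by
  have e1 := nhdsWithin_le_nhds (s := {n₀}ᶜ) (T.tendsto.eventually T.hasDerivAt)
  have e2 := nhdsWithin_le_nhds (s := {n₀}ᶜ)
    (((tendsto_sqrt n₀).mul T.tendsto).eventually T.hasDerivAt_sqrt)
  have e3 := nhdsWithin_le_nhds (s := {n₀}ᶜ) (T.tendsto.eventually_ne
    (show (k₀ : ℂ) ≠ 0 by exact_mod_cast T.k₀_pos.ne'))
  have e4 := nhdsWithin_le_nhds (s := {n₀}ᶜ) (lt_mem_nhds T.n₀_pos)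
  have e5 := nhdsWithin_le_nhds (s := {n₀}ᶜ) (gt_mem_nhds T.n₀_lt_one)
  have e6 := eventually_eventually_nhdsWithin.2 T.eq_map
  filter_upwards [e1, e2, e3, e4, e5, e6, T.differentiableAt, T.map_ne_zero, T.eq_map,
    self_mem_nhdsWithin] with n h1 h2 h3 h4 h5 h6 h7 h8 h9 h10
  rw [isOpen_compl_singleton.nhdsWithin_eq h10] at h6
  have hs0 : Real.sqrt n ≠ 0 := (Real.sqrt_pos.2 h4).ne'
  have hs0' : (Real.sqrt n : ℂ) ≠ 0 := by exact_mod_cast hs0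
  have hsq : (Real.sqrt n : ℂ) ^ 2 = n := by exact_mod_cast Real.sq_sqrt h4.le
  have d0 : HasDerivAt (fun m : ℝ => (Real.sqrt m : ℂ)) ((1 / (2 * Real.sqrt n) : ℝ) : ℂ) n :=
    (Real.hasDerivAt_sqrt h4.ne').ofReal_comp
  have d1 := h1.comp n h7.hasDerivAt
  have d2 := h2.comp n (d0.mul h7.hasDerivAt)
  have d3 := (d1.congr_of_eventuallyEq (f₁ := fun m => h ((Real.sqrt m : ℂ) * κ m))
    (by filter_upwards [h6] with m hm using hm.symm)).unique d2
  rw [← h9] at d3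
  have n1 : (n : ℂ) ≠ 0 := by exact_mod_cast h4.ne'
  have n2 : (1 - n : ℂ) ≠ 0 := by
    have : (1 - n : ℝ) ≠ 0 := by linarith
    exact_mod_cast this
  clear h9 d1 d2 h1 h2 h6 e1 e2 e6
  generalize h (κ n) = H at *
  rw [eq_div_iff (by simp only [ne_eq, mul_eq_zero, not_or]; simp [*])]
  push_cast at d3
  rw [mul_pow, hsq] at d3
  field_simp at d3
  rw [hsq] at d3
  refine mul_left_cancel₀ h3 ?_
  linear_combination d3

theorem _root_.hasDerivAt_of_tendsto_deriv {f : ℝ → ℂ} {e : ℂ} {x : ℝ}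
    (hd : ∀ᶠ y in nhdsWithin x {x}ᶜ, DifferentiableAt ℝ f y) (hc : ContinuousAt f x)
    (ht : Tendsto (deriv f) (nhdsWithin x {x}ᶜ) (nhds e)) : HasDerivAt f e x := by
  have hdo : DifferentiableOn ℝ f {y | DifferentiableAt ℝ f y} :=
    fun y hy => DifferentiableAt.differentiableWithinAt hy
  have hlt : nhdsWithin x (Iio x) ≤ nhdsWithin x {x}ᶜ :=
    nhdsWithin_mono _ fun y hy => ne_of_lt hy
  have hgt : nhdsWithin x (Ioi x) ≤ nhdsWithin x {x}ᶜ :=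
    nhdsWithin_mono _ fun y hy => ne_of_gt hy
  have hR := hasDerivWithinAt_Ici_of_tendsto_deriv hdo hc.continuousWithinAt (hgt hd)
    (ht.mono_left hgt)
  have hL := hasDerivWithinAt_Iic_of_tendsto_deriv hdo hc.continuousWithinAt (hlt hd)
    (ht.mono_left hlt)
  simpa using hL.union hR

theorem tendsto_cube_div (T : RiccatiTrajectory h q k₀ n₀ κ) :
    Tendsto (fun n : ℝ => h (κ n) ^ 3 / (n - n₀ : ℝ)) (nhdsWithin n₀ {n₀}ᶜ)
      (nhds ((3 / (2 * n₀ * (1 - n₀) * k₀ ^ 2) : ℝ) : ℂ)) := by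
  have hk : (k₀ : ℂ) ≠ 0 := by exact_mod_cast T.k₀_pos.ne'
  have hn : (n₀ : ℂ) ≠ 0 := by exact_mod_cast T.n₀_pos.ne'
  have hn1 : (1 - n₀ : ℂ) ≠ 0 := by
    have : (1 - n₀ : ℝ) ≠ 0 := by linarith [T.n₀_lt_one]
    exact_mod_cast this
  have e1 := nhdsWithin_le_nhds (s := {n₀}ᶜ) (T.tendsto.eventually T.hasDerivAt)
  have hd : ∀ᶠ n in nhdsWithin n₀ {n₀}ᶜ, HasDerivAt (fun n => h (κ n) ^ 3)
      (3 * h (κ n) ^ 2 * ((1 + (κ n ^ 2 - q) * h (κ n) ^ 2) / κ n * deriv κ n)) n := by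
    filter_upwards [e1, T.differentiableAt] with n h1 h2
    simpa using (h1.comp n h2.hasDerivAt).fun_pow 3
  have hlim : Tendsto (fun n : ℝ => 3 * ((1 + (κ n ^ 2 - q) * h (κ n) ^ 2) / κ n *
      ((1 + (n * κ n ^ 2 - q) * h (κ n) ^ 2) / (2 * n * κ n * (1 - n))))) (nhds n₀)
      (nhds (3 * ((1 + ((k₀ : ℂ) ^ 2 - q) * 0 ^ 2) / k₀ *
      ((1 + (n₀ * (k₀ : ℂ) ^ 2 - q) * 0 ^ 2) / (2 * n₀ * k₀ * (1 - n₀)))))) := by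
    have hK := T.tendsto
    have hH := T.tendsto_map
    have hN : Tendsto (fun n : ℝ => (n : ℂ)) (nhds n₀) (nhds (n₀ : ℂ)) :=
      Complex.continuous_ofReal.tendsto n₀
    have c1 {β : ℂ} : Tendsto (fun _ : ℝ => β) (nhds n₀) (nhds β) := tendsto_const_nhds
    refine c1.mul ((Tendsto.div (c1.add (((hK.pow 2).sub c1).mul (hH.pow 2))) hK hk).mul
      (Tendsto.div (c1.add (((hN.mul (hK.pow 2)).sub c1).mul (hH.pow 2)))
      (((c1.mul hN).mul hK).mul (c1.sub hN)) ?_))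
    simp [hk, hn, hn1]
  have hder : HasDerivAt (fun n => h (κ n) ^ 3)
      ((3 / (2 * n₀ * (1 - n₀) * k₀ ^ 2) : ℝ) : ℂ) n₀ := by
    refine hasDerivAt_of_tendsto_deriv (hd.mono fun n h => h.differentiableAt) ?_ ?_
    · have : ContinuousAt (fun n => h (κ n)) n₀ := by
        simpa [ContinuousAt, T.apply_n₀, T.map_k₀] using T.tendsto_map
      exact this.pow 3
    · have := hlim.mono_left (nhdsWithin_le_nhds (s := {n₀}ᶜ))
      convert! this.congr' ?_ using 2
      · push_cast
        field_simp
        ring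
      · filter_upwards [hd, T.deriv_eq, T.map_ne_zero] with n h1 h2 h3
        rw [h1.deriv, h2]
        field_simp
  refine (hasDerivAt_iff_tendsto_slope.1 hder).congr fun n => ?_
  simp only [slope_def_module, T.apply_n₀, T.map_k₀, Complex.real_smul]
  push_cast
  ring

theorem exists_tendsto_ratio (T : RiccatiTrajectory h q k₀ n₀ κ) {l : Filter ℝ} [l.NeBot]
    (hle : l ≤ nhdsWithin n₀ {n₀}ᶜ)
    (hl : ∀ s ∈ l, ∃ t ∈ l, t ⊆ s ∧ IsOpen t ∧ IsPreconnected t) :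
    ∃ c : ℝ, 0 < c ∧ ∃ ω : ℂ, ω ^ 3 = 1 ∧
      Tendsto (fun n => h (κ n) / (c * realCubeRoot (n - n₀) : ℝ)) l (nhds ω) := by
  have hCpos : 0 < 3 / (2 * n₀ * (1 - n₀) * k₀ ^ 2) := by
    have h1 := T.k₀_pos
    have h2 := T.n₀_pos
    have h3 : 0 < 1 - n₀ := by linarith [T.n₀_lt_one]
    positivity
  have hlim := T.tendsto_cube_div.mono_left hle
  generalize 3 / (2 * n₀ * (1 - n₀) * k₀ ^ 2) = C at hCpos hlim
  have hC0 : (C : ℂ) ≠ 0 := by exact_mod_cast hCpos.ne'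
  refine ⟨realCubeRoot C, realCubeRoot_pos hCpos, exists_tendsto_of_tendsto_cube hl ?_ ?_⟩
  · have e1 := nhdsWithin_le_nhds (s := {n₀}ᶜ) (T.tendsto.eventually T.hasDerivAt)
    filter_upwards [hle e1, hle T.differentiableAt, hle self_mem_nhdsWithin] with n h1 h2 h3
    have hs : ContinuousAt (fun n => ((realCubeRoot C * realCubeRoot (n - n₀) : ℝ) : ℂ)) n := by
      have := realCubeRoot.continuous
      fun_prop
    refine (ContinuousAt.comp h1.continuousAt h2.continuousAt).div hs ?_
    exact_mod_cast mul_ne_zero (realCubeRoot_pos hCpos).ne'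
      (realCubeRoot_ne_zero (sub_ne_zero.2 h3))
  · have := hlim.div_const (C : ℂ)
    rw [div_self hC0] at this
    refine this.congr fun n => ?_
    rw [div_pow, ← Complex.ofReal_pow, mul_pow, realCubeRoot_pow, realCubeRoot_pow, div_div,
      ← Complex.ofReal_mul, mul_comm C]

theorem tendsto_arg_deriv (T : RiccatiTrajectory h q k₀ n₀ κ) {l : Filter ℝ}
    (hle : l ≤ nhdsWithin n₀ {n₀}ᶜ) {σ : ℝ → ℝ} (hσ : ∀ᶠ n in l, σ n ≠ 0) {ω : ℂ}
    (hω : ω ^ 3 = 1) (hlim : Tendsto (fun n => h (κ n) / (σ n : ℂ)) l (nhds ω)) :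
    Tendsto (fun n => Complex.arg (deriv κ n)) l (nhds (Complex.arg ω)) := by
  have hk : (k₀ : ℂ) ≠ 0 := by exact_mod_cast T.k₀_pos.ne'
  have hn : (n₀ : ℂ) ≠ 0 := by exact_mod_cast T.n₀_pos.ne'
  have hn1 : (1 - n₀ : ℂ) ≠ 0 := by
    have : (1 - n₀ : ℝ) ≠ 0 := by linarith [T.n₀_lt_one]
    exact_mod_cast this
  have hω0 : ω ≠ 0 := fun h => by simp [h] at hω
  have hDpos : 0 < 1 / (2 * n₀ * k₀ * (1 - n₀)) := by
    have h1 := T.k₀_pos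
    have h2 := T.n₀_pos
    have h3 : 0 < 1 - n₀ := by linarith [T.n₀_lt_one]
    positivity
  have hle' : l ≤ nhds n₀ := hle.trans nhdsWithin_le_nhds
  have hA : Tendsto (fun n : ℝ => (1 + (n * κ n ^ 2 - q) * h (κ n) ^ 2) /
      (2 * n * κ n * (1 - n)) / (h (κ n) / (σ n : ℂ)) ^ 2) l
      (nhds ((1 + (n₀ * (k₀ : ℂ) ^ 2 - q) * 0 ^ 2) / (2 * n₀ * k₀ * (1 - n₀)) / ω ^ 2)) := by
    have hK := T.tendsto.mono_left hle'
    have hH := T.tendsto_map.mono_left hle'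
    have hN : Tendsto (fun n : ℝ => (n : ℂ)) l (nhds (n₀ : ℂ)) :=
      (Complex.continuous_ofReal.tendsto n₀).mono_left hle'
    have c1 {β : ℂ} : Tendsto (fun _ : ℝ => β) l (nhds β) := tendsto_const_nhds
    refine Tendsto.div (Tendsto.div (c1.add (((hN.mul (hK.pow 2)).sub c1).mul (hH.pow 2)))
      (((c1.mul hN).mul hK).mul (c1.sub hN)) ?_) (hlim.pow 2) (pow_ne_zero 2 hω0)
    simp [hk, hn, hn1]
  have hval : (1 + (n₀ * (k₀ : ℂ) ^ 2 - q) * 0 ^ 2) / (2 * n₀ * k₀ * (1 - n₀)) / ω ^ 2 =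
      ((1 / (2 * n₀ * k₀ * (1 - n₀)) : ℝ) : ℂ) * ω := by
    push_cast
    field_simp
    linear_combination -hω
  rw [hval] at hA
  have harg : Complex.arg (((1 / (2 * n₀ * k₀ * (1 - n₀)) : ℝ) : ℂ) * ω) = Complex.arg ω :=
    Complex.arg_real_mul _ hDpos
  have hslit : ((1 / (2 * n₀ * k₀ * (1 - n₀)) : ℝ) : ℂ) * ω ∈ Complex.slitPlane := by
    have := mem_slitPlane_of_cube hω
    rw [Complex.mem_slitPlane_iff_arg] at this ⊢
    rw [harg]
    exact ⟨this.1, mul_ne_zero (by exact_mod_cast hDpos.ne') hω0⟩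
  have hB := (Complex.continuousAt_arg hslit).tendsto.comp hA
  rw [harg] at hB
  refine hB.congr' ?_
  filter_upwards [hle T.deriv_eq, hσ] with n h1 h2
  have hσ2 : 0 < σ n ^ 2 := by positivity
  have h2' : (σ n : ℂ) ≠ 0 := by exact_mod_cast h2
  rw [Function.comp_apply, h1]
  refine Eq.trans ?_ (Complex.arg_mul_real hσ2 _)
  congr 1
  push_cast
  simp only [div_eq_mul_inv, mul_inv, mul_pow, inv_pow, inv_inv]
  ring

/-- Rolle's theorem on the vertical segment joining a point to its conjugate. -/
theorem _root_.exists_re_deriv_eq_zero_of_conj {f f' : ℂ → ℂ} {w : ℂ} (hw : w.im ≠ 0)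
    (h1 : f w = 0) (h2 : f (starRingEnd ℂ w) = 0)
    (hd : ∀ z : ℂ, z.re = w.re → |z.im| ≤ |w.im| → HasDerivAt f (f' z) z) :
    ∃ z : ℂ, z.re = w.re ∧ |z.im| ≤ |w.im| ∧ (f' z).re = 0 := by
  let γ : ℝ → ℂ := fun y => w.re + y * I
  have hγre (y : ℝ) : (γ y).re = w.re := by simp [γ]
  have hγim (y : ℝ) : (γ y).im = y := by simp [γ]
  have hγd (y : ℝ) : HasDerivAt γ I y := by
    simpa [γ] using ((hasDerivAt_id y).ofReal_comp.mul_const I).const_add (w.re : ℂ)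
  have hfd (y : ℝ) (hy : |y| ≤ |w.im|) :
      HasDerivAt (fun y => (f (γ y)).im) (f' (γ y)).re y := by
    have := (hd (γ y) (hγre y) (by rwa [hγim])).comp y (hγd y)
    convert! Complex.imCLM.hasFDerivAt.comp_hasDerivAt y this using 1
    simp
  have hend (y : ℝ) (hy : |y| = |w.im|) : (f (γ y)).im = 0 := by
    rcases abs_eq_abs.1 hy with h | h
    · have : γ y = w := Complex.ext (hγre y) (by rw [hγim, h])
      simp [this, h1]
    · have : γ y = starRingEnd ℂ w := Complex.ext (by simp [hγre]) (by simp [hγim, h])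
      simp [this, h2]
  have hpos : 0 < |w.im| := abs_pos.2 hw
  obtain ⟨y, hy, hy0⟩ := exists_hasDerivAt_eq_zero (a := -|w.im|) (b := |w.im|) (by linarith)
    (f := fun y => (f (γ y)).im) (f' := fun y => (f' (γ y)).re)
    (fun y hy => (hfd y (abs_le.2 hy)).continuousAt.continuousWithinAt)
    (by rw [hend _ (by simp), hend _ (by simp)])
    (fun y hy => hfd y (abs_le.2 ⟨hy.1.le, hy.2.le⟩))
  exact ⟨γ y, hγre y, by rw [hγim]; exact abs_le.2 ⟨hy.1.le, hy.2.le⟩, hy0⟩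

/-- Off the real axis, the derivative of `z ↦ h z - h (√n z)` has vanishing real part somewhere
between `κ n` and its conjugate. -/
theorem exists_re_eq_zero (T : RiccatiTrajectory h q k₀ n₀ κ) :
    ∀ᶠ n in nhdsWithin n₀ {n₀}ᶜ, (κ n).im ≠ 0 → ∃ z : ℂ, z.re = (κ n).re ∧
      |z.im| ≤ |(κ n).im| ∧ (((z ^ 2 - q) * h z ^ 2 -
        (((Real.sqrt n : ℂ) * z) ^ 2 - q) * h ((Real.sqrt n : ℂ) * z) ^ 2) / z).re = 0 := by
  have hk : (k₀ : ℂ) ≠ 0 := by exact_mod_cast T.k₀_pos.ne'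
  have hp : Tendsto (fun x : ℝ × ℂ => (Real.sqrt x.1 : ℂ) * x.2) (nhds n₀ ×ˢ nhds (k₀ : ℂ))
      (nhds ((Real.sqrt n₀ : ℂ) * (k₀ : ℂ))) :=
    ((tendsto_sqrt n₀).comp tendsto_fst).mul tendsto_snd
  obtain ⟨pa, hpa, pb, hpb, hpab⟩ := eventually_prod_iff.1 (hp.eventually T.hasDerivAt_sqrt)
  obtain ⟨δ, hδ, hball⟩ := Metric.eventually_nhds_iff_ball.1
    ((hpb.and T.hasDerivAt).and (eventually_ne_nhds hk))
  have e1 := nhdsWithin_le_nhds (s := {n₀}ᶜ) (T.tendsto.eventually (Metric.ball_mem_nhds _ hδ))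
  have e2 := nhdsWithin_le_nhds (s := {n₀}ᶜ) hpa
  have e3 := nhdsWithin_le_nhds (s := {n₀}ᶜ) (lt_mem_nhds T.n₀_pos)
  filter_upwards [e1, e2, e3, T.eq_map] with n h1 h2 h3 h4 him
  have hs0 : (Real.sqrt n : ℂ) ≠ 0 := by exact_mod_cast (Real.sqrt_pos.2 h3).ne'
  refine exists_re_deriv_eq_zero_of_conj (f := fun z => h z - h ((Real.sqrt n : ℂ) * z)) him
    (sub_eq_zero.2 h4) ?_ fun z hz1 hz2 => ?_
  · have : (Real.sqrt n : ℂ) * starRingEnd ℂ (κ n) = starRingEnd ℂ ((Real.sqrt n : ℂ) * κ n) := by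
      simp
    rw [this, T.map_conj, T.map_conj, h4, sub_self]
  · have hzb : z ∈ Metric.ball (k₀ : ℂ) δ := by
      rw [dist_eq_norm] at h1
      rw [mem_ball_iff_norm]
      refine lt_of_le_of_lt ?_ h1
      rw [Complex.norm_def, Complex.norm_def]
      refine Real.sqrt_le_sqrt ?_
      have := sq_le_sq.2 hz2
      simp only [Complex.normSq_apply, Complex.sub_re, Complex.sub_im, Complex.ofReal_re,
        Complex.ofReal_im, hz1]
      nlinarith
    obtain ⟨⟨hb1, hb2⟩, hz0⟩ := hball z hzb
    have d2 := (hpab h2 hb1).comp z ((hasDerivAt_id z).const_mul (Real.sqrt n : ℂ))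
    convert! hb2.sub d2 using 1
    field_simp
    ring

theorem tendsto_sub_div (T : RiccatiTrajectory h q k₀ n₀ κ) {l : Filter ℝ}
    (hle : l ≤ nhds n₀) {σ : ℝ → ℝ} (hlim : Tendsto (fun n => h (κ n) / (σ n : ℂ)) l (nhds 1)) :
    Tendsto (fun n => (κ n - k₀) / (σ n : ℂ)) l (nhds (k₀ : ℂ)) := by
  have hk : (k₀ : ℂ) ≠ 0 := by exact_mod_cast T.k₀_pos.ne'
  have hd := T.hasDerivAt.self_of_nhds
  have hc : ContinuousAt (dslope h k₀) k₀ := continuousAt_dslope_same.2 hd.differentiableAt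
  have hds := hc.tendsto.comp (T.tendsto.mono_left hle)
  rw [dslope_same, hd.deriv, T.map_k₀] at hds
  have hne : (1 + ((k₀ : ℂ) ^ 2 - q) * 0 ^ 2) / k₀ ≠ 0 := by simp [hk]
  have := hlim.div hds hne
  have hval : 1 / ((1 + ((k₀ : ℂ) ^ 2 - q) * 0 ^ 2) / k₀) = k₀ := by simp
  rw [hval] at this
  refine this.congr' ?_
  filter_upwards [hds.eventually_ne hne] with n hn
  have e := sub_smul_dslope h k₀ (κ n)
  rw [T.map_k₀, sub_zero, smul_eq_mul] at e
  rw [Function.comp_apply] at hn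
  change h (κ n) / σ n / dslope h k₀ (κ n) = _
  rw [← e]
  field_simp

theorem eventually_im_eq_zero (T : RiccatiTrajectory h q k₀ n₀ κ) {l : Filter ℝ}
    (hle : l ≤ nhdsWithin n₀ {n₀}ᶜ) {c : ℝ} (hc : 0 < c)
    (hlim : Tendsto (fun n => h (κ n) / (c * realCubeRoot (n - n₀) : ℝ)) l (nhds 1)) :
    ∀ᶠ n in l, (κ n).im = 0 := by
  have hle' : l ≤ nhds n₀ := hle.trans nhdsWithin_le_nhds
  have hk : (k₀ : ℂ) ≠ 0 := by exact_mod_cast T.k₀_pos.ne'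
  set σ : ℝ → ℝ := fun n => c * realCubeRoot (n - n₀) with hσdef
  have hσ0 : ∀ᶠ n in l, σ n ≠ 0 := by
    filter_upwards [hle self_mem_nhdsWithin] with n hn
    exact mul_ne_zero hc.ne' (realCubeRoot_ne_zero (sub_ne_zero.2 hn))
  have hσt : Tendsto σ l (nhds 0) := by
    have : ContinuousAt σ n₀ := by
      have := realCubeRoot.continuous
      fun_prop
    have h0 : σ n₀ = 0 := by simp [hσdef, realCubeRoot_zero]
    simpa [ContinuousAt, h0] using this.tendsto.mono_left hle'
  have hx (n : ℝ) : ∃ z : ℂ, z.re = (κ n).re ∧ |z.im| ≤ |(κ n).im| ∧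
      ((∃ z : ℂ, z.re = (κ n).re ∧
      |z.im| ≤ |(κ n).im| ∧ (((z ^ 2 - q) * h z ^ 2 -
        (((Real.sqrt n : ℂ) * z) ^ 2 - q) * h ((Real.sqrt n : ℂ) * z) ^ 2) / z).re = 0) →
      (((z ^ 2 - q) * h z ^ 2 -
        (((Real.sqrt n : ℂ) * z) ^ 2 - q) * h ((Real.sqrt n : ℂ) * z) ^ 2) / z).re = 0) := by
    by_cases hex : ∃ z : ℂ, z.re = (κ n).re ∧
      |z.im| ≤ |(κ n).im| ∧ (((z ^ 2 - q) * h z ^ 2 -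
        (((Real.sqrt n : ℂ) * z) ^ 2 - q) * h ((Real.sqrt n : ℂ) * z) ^ 2) / z).re = 0
    · obtain ⟨z, h1, h2, h3⟩ := hex
      exact ⟨z, h1, h2, fun _ => h3⟩
    · exact ⟨κ n, rfl, le_rfl, fun h => absurd h hex⟩
  choose ξ hξre hξim hξ using hx
  have hκσ : Tendsto (fun n => (κ n - k₀) / (σ n : ℂ)) l (nhds (k₀ : ℂ)) :=
    T.tendsto_sub_div hle' hlim
  have hre : Tendsto (fun n => ((ξ n).re - k₀) / σ n) l (nhds k₀) := by
    have := (Complex.continuous_re.tendsto _).comp hκσ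
    refine this.congr fun n => ?_
    simp [Complex.div_ofReal_re, hξre]
  have him : Tendsto (fun n => (ξ n).im / σ n) l (nhds 0) := by
    have := (Complex.continuous_im.tendsto _).comp hκσ
    rw [Complex.ofReal_im] at this
    have hnorm := this.norm
    rw [norm_zero] at hnorm
    refine squeeze_zero_norm (fun n => ?_) hnorm
    simp only [Function.comp_apply, Complex.div_ofReal_im, Complex.sub_im, Complex.ofReal_im,
      sub_zero, norm_div, Real.norm_eq_abs]
    exact div_le_div_of_nonneg_right (hξim n) (abs_nonneg _)
  have hξσ : Tendsto (fun n => (ξ n - k₀) / (σ n : ℂ)) l (nhds (k₀ : ℂ)) := by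
    have h1 := ((Complex.continuous_ofReal.tendsto _).comp hre).add
      (((Complex.continuous_ofReal.tendsto _).comp him).mul_const I)
    simp only [Complex.ofReal_zero, zero_mul, add_zero] at h1
    refine h1.congr fun n => ?_
    simp only [Function.comp_apply]
    nth_rw 3 [← Complex.re_add_im (ξ n)]
    push_cast
    ring
  have hσtC : Tendsto (fun n => (σ n : ℂ)) l (nhds 0) := by
    have := (Complex.continuous_ofReal.tendsto _).comp hσt
    rwa [Complex.ofReal_zero] at this
  have hξt : Tendsto ξ l (nhds (k₀ : ℂ)) := by
    have := (hξσ.mul hσtC).const_add (k₀ : ℂ)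
    rw [mul_zero, add_zero] at this
    refine this.congr' ?_
    filter_upwards [hσ0] with n hn
    have hn' : (σ n : ℂ) ≠ 0 := by exact_mod_cast hn
    field_simp
    ring
  have hrt := (tendsto_sqrt n₀).mono_left hle'
  have hsq0 : 0 < Real.sqrt n₀ := Real.sqrt_pos.2 T.n₀_pos
  have hrσ : Tendsto (fun n => (((Real.sqrt n - Real.sqrt n₀) / σ n : ℝ) : ℂ)) l (nhds 0) := by
    have h1 : Tendsto (fun n => σ n ^ 2 / (c ^ 3 * (Real.sqrt n + Real.sqrt n₀))) l
        (nhds (0 ^ 2 / (c ^ 3 * (Real.sqrt n₀ + Real.sqrt n₀)))) :=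
      (hσt.pow 2).div ((((Real.continuous_sqrt.tendsto n₀).mono_left hle').add_const _).const_mul _)
        (by positivity)
    have h2 := (Complex.continuous_ofReal.tendsto _).comp h1
    simp only [ne_eq, OfNat.ofNat_ne_zero, not_false_eq_true, zero_pow, zero_div,
      Complex.ofReal_zero] at h2
    refine h2.congr' ?_
    filter_upwards [hσ0, hle' (lt_mem_nhds T.n₀_pos)] with n h3 h4
    rw [Function.comp_apply]
    congr 1
    have hc3 : σ n ^ 3 = c ^ 3 * (n - n₀) := by simp only [hσdef, mul_pow, realCubeRoot_pow]
    have hsn := Real.sq_sqrt h4.le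
    have hsn0 := Real.sq_sqrt T.n₀_pos.le
    have hpos : 0 < Real.sqrt n + Real.sqrt n₀ := by positivity
    rw [div_eq_div_iff (by positivity) h3]
    linear_combination hc3 + c ^ 3 * (hsn0 - hsn)
  have hH := tendsto_comp_div_of_hasDerivAt T.hasDerivAt.self_of_nhds T.map_k₀ hξt hξσ
  have hH' := tendsto_comp_div_of_hasDerivAt (u := fun n => (Real.sqrt n : ℂ) * ξ n)
    (s := fun n => (σ n : ℂ)) (v := (Real.sqrt n₀ : ℂ) * k₀) T.hasDerivAt_sqrt.self_of_nhds
    T.map_sqrt (hrt.mul hξt) (by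
      have := (hrt.mul hξσ).add (hrσ.mul_const (k₀ : ℂ))
      rw [zero_mul, add_zero] at this
      refine this.congr fun n => ?_
      push_cast
      ring)
  have hrk : (Real.sqrt n₀ : ℂ) * k₀ ≠ 0 := mul_ne_zero (by exact_mod_cast hsq0.ne') hk
  rw [T.map_k₀, div_mul_cancel₀ _ hk] at hH
  rw [T.map_sqrt, div_mul_cancel₀ _ hrk] at hH'
  have hD := ((((hξt.pow 2).sub_const q).mul (hH.pow 2)).sub
    ((((hrt.mul hξt).pow 2).sub_const q).mul (hH'.pow 2))).div hξt hk
  have hval : (((k₀ : ℂ) ^ 2 - q) * (1 + ((k₀ : ℂ) ^ 2 - q) * 0 ^ 2) ^ 2 -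
      (((Real.sqrt n₀ : ℂ) * k₀) ^ 2 - q) *
        (1 + (((Real.sqrt n₀ : ℂ) * k₀) ^ 2 - q) * 0 ^ 2) ^ 2) / k₀ =
      ((k₀ * (1 - n₀) : ℝ) : ℂ) := by
    have : (Real.sqrt n₀ : ℂ) ^ 2 = n₀ := by exact_mod_cast Real.sq_sqrt T.n₀_pos.le
    field_simp
    push_cast
    rw [this]
    ring
  rw [hval] at hD
  have hDre := (Complex.continuous_re.tendsto _).comp hD
  have hpos : 0 < k₀ * (1 - n₀) := mul_pos T.k₀_pos (by linarith [T.n₀_lt_one])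
  filter_upwards [hDre.eventually (lt_mem_nhds (a := 0) (by simpa using hpos)),
    hle T.exists_re_eq_zero, hσ0] with n h1 h2 h3
  by_contra hne
  have h4 := hξ n (h2 hne)
  refine h1.ne' ?_
  rw [Function.comp_apply]
  have h5 : (((ξ n) ^ 2 - q) * (h (ξ n) / σ n) ^ 2 - (((Real.sqrt n : ℂ) * ξ n) ^ 2 - q) *
      (h ((Real.sqrt n : ℂ) * ξ n) / σ n) ^ 2) / ξ n =
      (((ξ n) ^ 2 - q) * h (ξ n) ^ 2 - (((Real.sqrt n : ℂ) * ξ n) ^ 2 - q) *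
      h ((Real.sqrt n : ℂ) * ξ n) ^ 2) / ξ n / ((σ n ^ 2 : ℝ) : ℂ) := by
    push_cast
    ring
  exact (congrArg Complex.re h5).trans (by rw [Complex.div_ofReal_re, h4, zero_div])

theorem exists_tendsto_arg_deriv (T : RiccatiTrajectory h q k₀ n₀ κ) {l : Filter ℝ} [l.NeBot]
    (hle : l ≤ nhdsWithin n₀ {n₀}ᶜ)
    (hl : ∀ s ∈ l, ∃ t ∈ l, t ⊆ s ∧ IsOpen t ∧ IsPreconnected t) :
    ∃ L : ℝ, Tendsto (fun n => Complex.arg (deriv κ n)) l (nhds L) ∧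
      L ∈ ({-(2 * Real.pi / 3), 0, 2 * Real.pi / 3} : Set ℝ) ∧
      (L = 0 ↔ ∀ᶠ n in l, (κ n).im = 0) := by
  obtain ⟨c, hc, ω, hω, hlim⟩ := T.exists_tendsto_ratio hle hl
  have hσ0 : ∀ᶠ n in l, c * realCubeRoot (n - n₀) ≠ 0 := by
    filter_upwards [hle self_mem_nhdsWithin] with n hn
    exact mul_ne_zero hc.ne' (realCubeRoot_ne_zero (sub_ne_zero.2 hn))
  have harg := T.tendsto_arg_deriv hle hσ0 hω hlim
  refine ⟨Complex.arg ω, harg, arg_mem_of_cube hω, fun h0 => ?_, fun hev => ?_⟩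
  · rw [eq_one_of_cube_of_arg_eq_zero hω h0] at hlim
    exact T.eventually_im_eq_zero hle hc hlim
  · obtain ⟨t, ht, hts, hto, -⟩ := hl _ (hev.and (hle T.differentiableAt))
    have hmem : ∀ᶠ n in l, Complex.arg (deriv κ n) ∈ ({0, Real.pi} : Set ℝ) := by
      filter_upwards [ht] with n hn
      have hd := Complex.imCLM.hasFDerivAt.comp_hasDerivAt n (hts hn).2.hasDerivAt
      have h0 : (deriv κ n).im = 0 := by
        refine hd.unique ((hasDerivAt_const n (0 : ℝ)).congr_of_eventuallyEq ?_)
        filter_upwards [hto.mem_nhds hn] with m hm using (hts hm).1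
      rcases le_or_gt 0 (deriv κ n).re with h | h
      · left
        exact Complex.arg_eq_zero_iff.2 ⟨h, h0⟩
      · right
        exact Complex.arg_eq_pi_iff.2 ⟨h, h0⟩
    have hL := (Set.toFinite ({0, Real.pi} : Set ℝ)).isClosed.mem_of_tendsto harg hmem
    rcases hL with h | h
    · exact h
    · exact absurd h (Complex.mem_slitPlane_iff_arg.1 (mem_slitPlane_of_cube hω)).1

end RiccatiTrajectory

/-- The quotient `J_p(z) / (z J_p'(z))`. -/
noncomputable def besselRatio (p : ℕ) (z : ℂ) : ℂ := besselEuler p 0 z / besselEuler p 1 z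

theorem hasDerivAt_besselRatio (p : ℕ) {z : ℂ} (hz : z ≠ 0) (h1 : besselEuler p 1 z ≠ 0) :
    HasDerivAt (besselRatio p)
      ((1 + (z ^ 2 - (p : ℂ) ^ 2) * besselRatio p z ^ 2) / z) z := by
  convert! (hasDerivAt_besselEuler p 0 hz).div (hasDerivAt_besselEuler p 1 hz) h1 using 1
  rw [besselEuler_two, besselRatio]
  field_simp
  ring

theorem eventually_hasDerivAt_besselRatio (p : ℕ) {k : ℂ} (hk : k ≠ 0)
    (h1 : besselEuler p 1 k ≠ 0) :
    ∀ᶠ z in nhds k, HasDerivAt (besselRatio p)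
      ((1 + (z ^ 2 - (p : ℂ) ^ 2) * besselRatio p z ^ 2) / z) z := by
  filter_upwards [(differentiable_besselEuler p 1).continuous.continuousAt.eventually_ne h1,
    eventually_ne_nhds hk] with z hz1 hz2
  exact hasDerivAt_besselRatio p hz2 hz1

theorem Fp_eq (p : ℕ) (z : ℂ) (n : ℝ) :
    Fp p z n = besselEuler p 1 z * besselEuler p 0 ((Real.sqrt n : ℂ) * z) -
      besselEuler p 0 z * besselEuler p 1 ((Real.sqrt n : ℂ) * z) := by
  rw [Fp, ← mul_besselJ', ← mul_besselJ', besselEuler_zero]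
  ring

theorem exists_isOpen_isPreconnected_of_mem_nhdsGT {a : ℝ} :
    ∀ s ∈ nhdsWithin a (Ioi a), ∃ t ∈ nhdsWithin a (Ioi a),
      t ⊆ s ∧ IsOpen t ∧ IsPreconnected t := by
  intro s hs
  obtain ⟨u, hu, hus⟩ := mem_nhdsGT_iff_exists_Ioo_subset.1 hs
  exact ⟨Ioo a u, Ioo_mem_nhdsGT hu, hus, isOpen_Ioo, isPreconnected_Ioo⟩

theorem exists_isOpen_isPreconnected_of_mem_nhdsLT {a : ℝ} :
    ∀ s ∈ nhdsWithin a (Iio a), ∃ t ∈ nhdsWithin a (Iio a),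
      t ⊆ s ∧ IsOpen t ∧ IsPreconnected t := by
  intro s hs
  obtain ⟨u, hu, hus⟩ := mem_nhdsLT_iff_exists_Ioo_subset.1 hs
  exact ⟨Ioo u a, Ioo_mem_nhdsLT hu, hus, isOpen_Ioo, isPreconnected_Ioo⟩

theorem eventually_nhdsGT_iff_exists_le {a ε : ℝ} (hε : 0 < ε) {P : ℝ → Prop} :
    (∀ᶠ n in nhdsWithin a (Ioi a), P n) ↔ ∃ δ > 0, δ ≤ ε ∧ ∀ n ∈ Ioo a (a + δ), P n := by
  constructor
  · intro h
    obtain ⟨u, hu, hus⟩ := mem_nhdsGT_iff_exists_Ioo_subset.1 h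
    have hu' : a < u := hu
    refine ⟨min (u - a) ε, lt_min (by linarith) hε, min_le_right _ _, fun n hn => hus ⟨hn.1, ?_⟩⟩
    linarith [hn.2, min_le_left (u - a) ε]
  · rintro ⟨δ, hδ, -, h⟩
    filter_upwards [Ioo_mem_nhdsGT (show a < a + δ by linarith)] with n hn using h n hn

theorem eventually_nhdsLT_iff_exists_le {a ε : ℝ} (hε : 0 < ε) {P : ℝ → Prop} :
    (∀ᶠ n in nhdsWithin a (Iio a), P n) ↔ ∃ δ > 0, δ ≤ ε ∧ ∀ n ∈ Ioo (a - δ) a, P n := by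
  constructor
  · intro h
    obtain ⟨u, hu, hus⟩ := mem_nhdsLT_iff_exists_Ioo_subset.1 h
    have hu' : u < a := hu
    refine ⟨min (a - u) ε, lt_min (by linarith) hε, min_le_right _ _, fun n hn => hus ⟨?_, hn.2⟩⟩
    linarith [hn.1, min_le_left (a - u) ε]
  · rintro ⟨δ, hδ, -, h⟩
    filter_upwards [Ioo_mem_nhdsLT (show a - δ < a by linarith)] with n hn using h n hn

/-- admissible approach angles of ITE trajectories at an IDE for `0 < n* < 1`. -/
theorem stmt_8 (p : ℕ) (nst : ℝ) (hnst0 : 0 < nst) (hnst : nst < 1) (ε : ℝ) (hε : 0 < ε)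
    (hεd : 0 < nst - ε)
    (κ : ℝ → ℂ) (hcont : ContinuousOn κ (Set.Ioo (nst - ε) (nst + ε)))
    (hF : ∀ n ∈ Set.Ioo (nst - ε) (nst + ε), Fp p (κ n) n = 0)
    (hdiff : ∀ n ∈ Set.Ioo (nst - ε) (nst + ε), n ≠ nst → DifferentiableAt ℝ κ n)
    (κs : ℝ) (hκs : 0 < κs) (hval : κ nst = (κs : ℂ))
    (hJ : besselJ p (κs : ℂ) = 0) (hJ' : besselJ' p (κs : ℂ) ≠ 0)
    (hJne : ∀ n ∈ Set.Ioo (nst - ε) (nst + ε), n ≠ nst →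
      besselJ p (κ n) ≠ 0 ∧ besselJ p ((Real.sqrt n : ℂ) * κ n) ≠ 0) :
    ∃ Lm Lp : ℝ,
      Filter.Tendsto (fun n => Complex.arg (deriv κ n))
        (nhdsWithin nst (Set.Ioo (nst - ε) nst)) (nhds Lm) ∧
      Filter.Tendsto (fun n => Complex.arg (deriv κ n))
        (nhdsWithin nst (Set.Ioo nst (nst + ε))) (nhds Lp) ∧
      Lm ∈ ({-(2 * Real.pi / 3), 0, 2 * Real.pi / 3} : Set ℝ) ∧
      Lp ∈ ({-(2 * Real.pi / 3), 0, 2 * Real.pi / 3} : Set ℝ) ∧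
      (Lm = 0 ↔ ∃ δ > 0, δ ≤ ε ∧ ∀ n ∈ Set.Ioo (nst - δ) nst, (κ n).im = 0) ∧
      (Lp = 0 ↔ ∃ δ > 0, δ ≤ ε ∧ ∀ n ∈ Set.Ioo nst (nst + δ), (κ n).im = 0) := by
  have hball : Ioo (nst - ε) (nst + ε) ∈ nhds nst := Ioo_mem_nhds (by linarith) (by linarith)
  have hmem : nst ∈ Ioo (nst - ε) (nst + ε) := mem_of_mem_nhds hball
  have hball' := nhdsWithin_le_nhds (s := {nst}ᶜ) hball
  have hk : (κs : ℂ) ≠ 0 := by exact_mod_cast hκs.ne'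
  have hs : (Real.sqrt nst : ℂ) ≠ 0 := by exact_mod_cast (Real.sqrt_pos.2 hnst0).ne'
  have hrk := mul_ne_zero hs hk
  rw [← besselEuler_zero] at hJ
  have hJ1 : besselEuler p 1 κs ≠ 0 := by
    rw [← mul_besselJ']
    exact mul_ne_zero hk hJ'
  have hJr : besselEuler p 0 ((Real.sqrt nst : ℂ) * κs) = 0 := by
    have := hF nst hmem
    rw [hval, Fp_eq, hJ, zero_mul, sub_zero] at this
    exact (mul_eq_zero.1 this).resolve_left hJ1
  have hJr1 : besselEuler p 1 ((Real.sqrt nst : ℂ) * κs) ≠ 0 := fun h0 => by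
    have hz := besselEuler_zero_eq_zero_of_common_zero p hrk hJr h0
    refine hJ1 ?_
    rw [← mul_deriv_besselEuler, show besselEuler p 0 = fun _ => 0 from funext hz]
    simp
  have hcontAt : ContinuousAt κ nst := hcont.continuousAt hball
  have hκt : Tendsto κ (nhds nst) (nhds (κs : ℂ)) := by simpa [hval] using hcontAt.tendsto
  have hne1 : ∀ᶠ n in nhdsWithin nst {nst}ᶜ, besselEuler p 1 (κ n) ≠ 0 :=
    nhdsWithin_le_nhds (hκt.eventually
      ((differentiable_besselEuler p 1).continuous.continuousAt.eventually_ne hJ1))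
  have hne2 : ∀ᶠ n in nhdsWithin nst {nst}ᶜ,
      besselEuler p 1 ((Real.sqrt n : ℂ) * κ n) ≠ 0 :=
    nhdsWithin_le_nhds (((RiccatiTrajectory.tendsto_sqrt nst).mul hκt).eventually
      ((differentiable_besselEuler p 1).continuous.continuousAt.eventually_ne hJr1))
  have T : RiccatiTrajectory (besselRatio p) ((p : ℂ) ^ 2) κs nst κ :=
    { k₀_pos := hκs
      n₀_pos := hnst0
      n₀_lt_one := hnst
      hasDerivAt := eventually_hasDerivAt_besselRatio p hk hJ1
      hasDerivAt_sqrt := eventually_hasDerivAt_besselRatio p hrk hJr1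
      map_k₀ := by rw [besselRatio, hJ, zero_div]
      map_sqrt := by rw [besselRatio, hJr, zero_div]
      map_conj := fun z => by simp only [besselRatio, besselEuler_conj, map_div₀]
      continuousAt := hcontAt
      apply_n₀ := hval
      differentiableAt := by
        filter_upwards [hball', self_mem_nhdsWithin] with n h1 h2 using hdiff n h1 h2
      eq_map := by
        filter_upwards [hball', hne1, hne2] with n h1 h2 h3
        have := hF n h1
        rw [Fp_eq] at this
        rw [besselRatio, besselRatio, div_eq_div_iff h2 h3]
        linear_combination -this
      map_ne_zero := by
        filter_upwards [hball', self_mem_nhdsWithin, hne1] with n h1 h2 h3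
        refine div_ne_zero ?_ h3
        rw [besselEuler_zero]
        exact (hJne n h1 h2).1 }
  rw [nhdsWithin_Ioo_eq_nhdsLT (by linarith), nhdsWithin_Ioo_eq_nhdsGT (by linarith)]
  obtain ⟨Lm, hm1, hm2, hm3⟩ := T.exists_tendsto_arg_deriv
    (l := nhdsWithin nst (Iio nst)) (nhdsWithin_mono nst fun n (hn : n < nst) => hn.ne)
    exists_isOpen_isPreconnected_of_mem_nhdsLT
  obtain ⟨Lp, hp1, hp2, hp3⟩ := T.exists_tendsto_arg_deriv
    (l := nhdsWithin nst (Ioi nst)) (nhdsWithin_mono nst fun n (hn : nst < n) => hn.ne')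
    exists_isOpen_isPreconnected_of_mem_nhdsGT
  exact ⟨Lm, Lp, hm1, hp1, hm2, hp2, hm3.trans (eventually_nhdsLT_iff_exists_le hε),
    hp3.trans (eventually_nhdsGT_iff_exists_le hε)⟩
end

section
/- Let p ≥ 0 be an integer, n* > 0 with n* ≠ 1, ε > 0, and let κ : (n*−ε, n*+ε) → ℂ be a continuous ITE trajectory (F_p(κ(n), n) = 0 for all n) with Im κ(n) ≠ 0 for every n ≠ n*, κ(n*) = κ* > 0, J_p(κ*) = 0 and J_p'(κ*) ≠ 0. Then there exist δ ∈ (0, ε] and a continuous real-valued function κ̃ : (n*−δ, n*+δ) → ℝ such that F_p(κ̃(n), n) = 0 for all n ∈ (n*−δ, n*+δ) and κ̃(n*) = κ*. -/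
open Complex Real Filter Set

open Topology

/-- The `m`-th term of the power series of `besselJ p` at `z`. -/
noncomputable def besselTerm (p m : ℕ) (z : ℂ) : ℂ :=
  ((-1 : ℂ) ^ m / ((Nat.factorial m : ℂ) * (Nat.factorial (m + p) : ℂ))) * (z / 2) ^ (2 * m + p)

theorem norm_besselTerm_le (p m : ℕ) {z : ℂ} {R : ℝ} (hz : ‖z‖ ≤ R) :
    ‖besselTerm p m z‖ ≤ (R / 2) ^ p * (((R / 2) ^ 2) ^ m / (m.factorial : ℝ)) := by
  have hR : 0 ≤ R := (norm_nonneg z).trans hz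
  have h1 : ‖besselTerm p m z‖
      = (‖z‖ / 2) ^ (2 * m + p) / ((m.factorial : ℝ) * ((m + p).factorial : ℝ)) := by
    simp [besselTerm, div_eq_mul_inv]
    ring
  have h2 : (1 : ℝ) ≤ ((m + p).factorial : ℝ) := by exact_mod_cast Nat.factorial_pos _
  have h3 : (0 : ℝ) < (m.factorial : ℝ) := by exact_mod_cast Nat.factorial_pos _
  rw [h1]
  calc (‖z‖ / 2) ^ (2 * m + p) / ((m.factorial : ℝ) * ((m + p).factorial : ℝ))
      ≤ (R / 2) ^ (2 * m + p) / (m.factorial : ℝ) := by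
        gcongr
        exact le_mul_of_one_le_right h3.le h2
    _ = (R / 2) ^ p * (((R / 2) ^ 2) ^ m / (m.factorial : ℝ)) := by
        rw [pow_add, pow_mul]; ring

theorem tendstoLocallyUniformlyOn_besselJ (p : ℕ) :
    TendstoLocallyUniformlyOn (fun N z => ∑ m ∈ Finset.range N, besselTerm p m z) (besselJ p)
      atTop univ := by
  rw [tendstoLocallyUniformlyOn_iff_forall_isCompact isOpen_univ]
  intro K _ hK
  obtain ⟨R, hR⟩ := hK.isBounded.exists_norm_le
  exact tendstoUniformlyOn_tsum_nat
    ((Real.summable_pow_div_factorial ((R / 2) ^ 2)).mul_left ((R / 2) ^ p))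
    fun m z hz => norm_besselTerm_le p m (hR z hz)

theorem hasDerivAt_besselTerm (p m : ℕ) (z : ℂ) :
    HasDerivAt (besselTerm p m)
      (((-1 : ℂ) ^ m / ((Nat.factorial m : ℂ) * (Nat.factorial (m + p) : ℂ))) *
        (((2 * m + p : ℕ) : ℂ) * (z / 2) ^ (2 * m + p - 1) * (1 / 2))) z :=
  (((hasDerivAt_id z).div_const 2).pow (2 * m + p)).const_mul _

theorem differentiable_besselTerm (p m : ℕ) : Differentiable ℂ (besselTerm p m) :=
  fun z => (hasDerivAt_besselTerm p m z).differentiableAt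

theorem mul_deriv_besselTerm (p m : ℕ) (z : ℂ) :
    z * deriv (besselTerm p m) z = (2 * m + p : ℕ) * besselTerm p m z := by
  rw [(hasDerivAt_besselTerm p m z).deriv, besselTerm]
  rcases Nat.eq_zero_or_pos (2 * m + p) with h | h
  · simp [h]
  · obtain ⟨k, hk⟩ := Nat.exists_eq_succ_of_ne_zero h.ne'
    rw [hk]
    simp only [Nat.succ_eq_add_one, Nat.add_sub_cancel, pow_succ]
    ring

theorem differentiable_besselJ (p : ℕ) : Differentiable ℂ (besselJ p) := by
  rw [← differentiableOn_univ]
  exact (tendstoLocallyUniformlyOn_besselJ p).differentiableOn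
    (.of_forall fun N => (Differentiable.fun_sum fun m _ =>
      differentiable_besselTerm p m).differentiableOn) isOpen_univ

theorem hasDerivAt_besselJ (p : ℕ) (z : ℂ) : HasDerivAt (besselJ p) (besselJ' p z) z :=
  (differentiable_besselJ p z).hasDerivAt

theorem besselTerm_index_shift (p m : ℕ) (z : ℂ) :
    (((2 * (m + 1) + p : ℕ) : ℂ) ^ 2 - (p : ℂ) ^ 2) * besselTerm p (m + 1) z
      = -z ^ 2 * besselTerm p m z := by
  have h1 : ((m.factorial : ℕ) : ℂ) ≠ 0 := by exact_mod_cast Nat.factorial_ne_zero _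
  have h2 : (((m + p).factorial : ℕ) : ℂ) ≠ 0 := by exact_mod_cast Nat.factorial_ne_zero _
  have h3 : ((m : ℂ) + 1) ≠ 0 := by exact_mod_cast Nat.succ_ne_zero m
  have h4 : ((m : ℂ) + p + 1) ≠ 0 := by exact_mod_cast Nat.succ_ne_zero (m + p)
  have e1 : m + 1 + p = m + p + 1 := by ring
  have e2 : 2 * (m + 1) + p = 2 * m + p + 2 := by ring
  simp only [besselTerm, e1, e2, Nat.factorial_succ, pow_add]
  push_cast
  field_simp
  ring

/-- The Bessel equation, in terms of the Euler derivative `z J'(z)`. -/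
theorem hasDerivAt_mul_besselJ' (p : ℕ) {z : ℂ} (hz : z ≠ 0) :
    HasDerivAt (fun z => z * besselJ' p z) (-(z - (p : ℂ) ^ 2 / z) * besselJ p z) z := by
  set S : ℕ → ℂ → ℂ := fun N z => ∑ m ∈ Finset.range N, besselTerm p m z with hS
  set T : ℕ → ℂ → ℂ := fun N z => ∑ m ∈ Finset.range N, (2 * m + p : ℕ) * besselTerm p m z with hT
  have hSd : ∀ N, Differentiable ℂ (S N) := fun N =>
    Differentiable.fun_sum fun m _ => differentiable_besselTerm p m
  have hST : ∀ N z, z * deriv (S N) z = T N z := by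
    intro N z
    have : deriv (S N) z = ∑ m ∈ Finset.range N, deriv (besselTerm p m) z :=
      deriv_fun_sum fun m _ => differentiable_besselTerm p m z
    simp only [this, hT, Finset.mul_sum, mul_deriv_besselTerm]
  have hTT : ∀ N z, z * deriv (T N) z
      = ∑ m ∈ Finset.range N, ((2 * m + p : ℕ) : ℂ) ^ 2 * besselTerm p m z := by
    intro N z
    have : deriv (T N) z
        = ∑ m ∈ Finset.range N, ((2 * m + p : ℕ) : ℂ) * deriv (besselTerm p m) z := by
      simp only [hT]
      rw [deriv_fun_sum fun m _ => (differentiable_besselTerm p m z).const_mul _]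
      exact Finset.sum_congr rfl fun m _ =>
        deriv_const_mul _ (differentiable_besselTerm p m z)
    simp only [this, Finset.mul_sum]
    refine Finset.sum_congr rfl fun m _ => ?_
    rw [mul_left_comm, mul_deriv_besselTerm]; ring
  have hode : ∀ N z, z * deriv (T (N + 1)) z - (p : ℂ) ^ 2 * S (N + 1) z = -z ^ 2 * S N z := by
    intro N z
    rw [hTT]
    simp only [hS, Finset.mul_sum, ← Finset.sum_sub_distrib, ← sub_mul]
    rw [Finset.sum_range_succ']
    simp only [besselTerm_index_shift]
    simp
  have hdS : TendstoLocallyUniformlyOn (deriv ∘ S) (besselJ' p) atTop univ :=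
    (tendstoLocallyUniformlyOn_besselJ p).deriv
      (.of_forall fun N => (hSd N).differentiableOn) isOpen_univ
  have hddS : TendstoLocallyUniformlyOn (deriv ∘ (deriv ∘ S)) (deriv (besselJ' p)) atTop univ :=
    hdS.deriv (.of_forall fun N => ((hSd N).deriv).differentiableOn) isOpen_univ
  have hdT : ∀ N, deriv (T N) z = deriv (S N) z + z * deriv (deriv (S N)) z := by
    intro N
    rw [← funext (hST N)]
    simpa using ((hasDerivAt_id z).fun_mul (((hSd N).deriv z).hasDerivAt)).deriv
  have hlimT : Tendsto (fun N => deriv (T N) z) atTop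
      (𝓝 (besselJ' p z + z * deriv (besselJ' p) z)) := by
    simp only [hdT]
    exact (hdS.tendsto_at (mem_univ z)).add ((hddS.tendsto_at (mem_univ z)).const_mul z)
  have hlimS := (tendstoLocallyUniformlyOn_besselJ p).tendsto_at (mem_univ z)
  have hlim : z * (besselJ' p z + z * deriv (besselJ' p) z) - (p : ℂ) ^ 2 * besselJ p z
      = -z ^ 2 * besselJ p z := by
    refine tendsto_nhds_unique ?_ (hlimS.const_mul (-z ^ 2))
    refine Tendsto.congr (fun N => hode N z) ?_
    exact ((hlimT.comp (tendsto_add_atTop_nat 1)).const_mul z).sub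
      ((hlimS.comp (tendsto_add_atTop_nat 1)).const_mul _)
  have hW := (hasDerivAt_id z).mul ((differentiable_besselJ p).deriv z).hasDerivAt
  refine hW.congr_deriv ?_
  change 1 * besselJ' p z + z * deriv (besselJ' p) z = _
  field_simp
  linear_combination hlim

/-- The restriction of `besselJ p` to the real line. -/
noncomputable def realBesselJ (p : ℕ) (x : ℝ) : ℝ := (besselJ p x).re

/-- The Euler derivative `x J_p'(x)` on the real line. -/
noncomputable def realBesselEuler (p : ℕ) (x : ℝ) : ℝ := x * (besselJ' p x).re

theorem ofReal_realBesselJ (p : ℕ) (x : ℝ) : (realBesselJ p x : ℂ) = besselJ p x := by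
  rw [realBesselJ, ← Complex.conj_eq_iff_re, besselJ, Complex.conj_tsum]
  simp [Complex.conj_ofNat]

theorem ofReal_besselJ'_re (p : ℕ) (x : ℝ) : ((besselJ' p x).re : ℂ) = besselJ' p x := by
  have h := (hasDerivAt_besselJ p x).comp_ofReal
  have h1 : HasDerivAt (realBesselJ p) (besselJ' p x).re x := (hasDerivAt_besselJ p x).real_of_complex
  have h2 := h1.ofReal_comp
  simp only [ofReal_realBesselJ] at h2
  exact h2.unique h

theorem ofReal_realBesselEuler (p : ℕ) (x : ℝ) :
    (realBesselEuler p x : ℂ) = x * besselJ' p x := by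
  rw [realBesselEuler, ofReal_mul, ofReal_besselJ'_re]

theorem hasDerivAt_realBesselJ (p : ℕ) {x : ℝ} (hx : x ≠ 0) :
    HasDerivAt (realBesselJ p) (realBesselEuler p x / x) x := by
  rw [realBesselEuler, mul_div_cancel_left₀ _ hx]
  exact (hasDerivAt_besselJ p x).real_of_complex

theorem hasDerivAt_realBesselEuler (p : ℕ) {x : ℝ} (hx : x ≠ 0) :
    HasDerivAt (realBesselEuler p) (-(x - (p : ℝ) ^ 2 / x) * realBesselJ p x) x := by
  have h := (hasDerivAt_mul_besselJ' p (ofReal_ne_zero.2 hx)).real_of_complex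
  simp only [← ofReal_realBesselEuler, ← ofReal_realBesselJ] at h
  refine h.congr_deriv ?_
  norm_cast

/-- A positive zero of the Bessel function is simple, provided the Euler derivative is nonzero at
some positive point. -/
theorem realBesselEuler_ne_zero {p : ℕ} {a b : ℝ} (ha : 0 < a) (hb : 0 < b)
    (hwa : realBesselEuler p a ≠ 0) (hjb : realBesselJ p b = 0) : realBesselEuler p b ≠ 0 := by
  intro hwb
  set l := min a b / 2 with hl
  set L := max a b + 1 with hL
  have hl0 : 0 < l := by positivity
  have mem : ∀ x, 0 < x → min a b ≤ x → x ≤ max a b → x ∈ Ioo l L := fun x hx h1 h2 =>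
    ⟨by have := lt_min ha hb; linarith, by linarith⟩
  let v : ℝ → ℝ × ℝ → ℝ × ℝ := fun t y => (y.2 / t, -(t - (p : ℝ) ^ 2 / t) * y.1)
  let K : ℝ := max (1 / l) (L + (p : ℝ) ^ 2 / l)
  have hK0 : 0 ≤ K := le_max_of_le_left (by positivity)
  have hv : ∀ t ∈ Ioo l L, LipschitzOnWith ⟨K, hK0⟩ (v t) univ := by
    intro t ht
    have ht0 : 0 < t := hl0.trans ht.1
    refine LipschitzOnWith.of_dist_le_mul fun y _ y' _ => ?_
    have hy1 : |y.1 - y'.1| ≤ dist y y' := (Real.dist_eq _ _).symm.trans_le (le_max_left _ _)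
    have hy2 : |y.2 - y'.2| ≤ dist y y' := (Real.dist_eq _ _).symm.trans_le (le_max_right _ _)
    have hc1 : 1 / t ≤ K := (one_div_le_one_div_of_le hl0 ht.1.le).trans (le_max_left _ _)
    have hc2 : |t - (p : ℝ) ^ 2 / t| ≤ K := by
      refine le_trans ?_ (le_max_right _ _)
      refine (abs_sub _ _).trans ?_
      rw [abs_of_pos ht0, abs_of_nonneg (by positivity)]
      gcongr
      exacts [ht.2.le, ht.1.le]
    refine max_le ?_ ?_
    · change dist (y.2 / t) (y'.2 / t) ≤ K * dist y y'
      rw [Real.dist_eq, ← sub_div, abs_div, abs_of_pos ht0, div_eq_mul_one_div, mul_comm]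
      gcongr
    · change dist (-(t - (p : ℝ) ^ 2 / t) * y.1) (-(t - (p : ℝ) ^ 2 / t) * y'.1) ≤ K * dist y y'
      rw [Real.dist_eq, ← mul_sub, abs_mul, abs_neg]
      gcongr
  have hEq := ODE_solution_unique_of_mem_Ioo (v := v) (s := fun _ => univ)
    (f := fun x => (realBesselJ p x, realBesselEuler p x)) (g := fun _ => 0) hv
    (mem b hb (min_le_right _ _) (le_max_right _ _))
    (fun t ht => ⟨(hasDerivAt_realBesselJ p (hl0.trans ht.1).ne').prodMk
      (hasDerivAt_realBesselEuler p (hl0.trans ht.1).ne'), mem_univ _⟩)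
    (fun t _ => ⟨(hasDerivAt_const t (0 : ℝ × ℝ)).congr_deriv (by simp [v]; rfl), mem_univ _⟩)
    (by simp [hjb, hwb])
  exact hwa (congrArg Prod.snd (hEq (mem a ha (min_le_left _ _) (le_max_left _ _))))

/-- Near a simple zero `a`, the Bessel function and its Euler derivative have ratio `τ` at a
point `A τ` depending differentiably on `τ`. -/
theorem exists_realBessel_ratio_inverse {p : ℕ} {a : ℝ} (ha : 0 < a)
    (hj : realBesselJ p a = 0) (hw : realBesselEuler p a ≠ 0) :
    ∃ A : ℝ → ℝ, A 0 = a ∧ ∀ᶠ τ in 𝓝 0, 0 < A τ ∧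
      realBesselJ p (A τ) = τ * realBesselEuler p (A τ) ∧
      0 < 1 + (A τ ^ 2 - (p : ℝ) ^ 2) * τ ^ 2 ∧
      HasDerivAt A (A τ / (1 + (A τ ^ 2 - (p : ℝ) ^ 2) * τ ^ 2)) τ := by
  set j := realBesselJ p with hjdef
  set w := realBesselEuler p with hwdef
  set g : ℝ → ℝ := fun x => j x / w x with hg
  have hg' : ∀ x, 0 < x → w x ≠ 0 →
      HasDerivAt g ((1 + (x ^ 2 - (p : ℝ) ^ 2) * g x ^ 2) / x) x := by
    intro x hx hwx
    refine ((hasDerivAt_realBesselJ p hx.ne').fun_div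
      (hasDerivAt_realBesselEuler p hx.ne') hwx).congr_deriv ?_
    simp only [hg, ← hjdef, ← hwdef]
    field_simp
    ring
  have hwc : ContinuousAt w a := (hasDerivAt_realBesselEuler p ha.ne').continuousAt
  have hgc : ContinuousAt g a := (hg' a ha hw).continuousAt
  have hga : g a = 0 := by simp [hg, hj]
  have hgood : ∀ᶠ x in 𝓝 a, 0 < x ∧ w x ≠ 0 := (lt_mem_nhds ha).and (hwc.eventually_ne hw)
  have hstrict : HasStrictDerivAt g ((1 + (a ^ 2 - (p : ℝ) ^ 2) * g a ^ 2) / a) a := by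
    refine hasStrictDerivAt_of_hasDerivAt_of_continuousAt
      (f' := fun x => (1 + (x ^ 2 - (p : ℝ) ^ 2) * g x ^ 2) / x) (hgood.mono fun x hx => hg' x hx.1 hx.2) ?_
    exact (continuousAt_const.add
      (((continuousAt_id.pow 2).sub continuousAt_const).mul (hgc.pow 2))).div continuousAt_id ha.ne'
  have hne : (1 + (a ^ 2 - (p : ℝ) ^ 2) * g a ^ 2) / a ≠ 0 := by simp [hga, ha.ne']
  set e := (hstrict.hasStrictFDerivAt_equiv hne).toOpenPartialHomeomorph g
  have hsrc : a ∈ e.source := (hstrict.hasStrictFDerivAt_equiv hne).mem_toOpenPartialHomeomorph_source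
  have heg : ∀ x, e x = g x := fun x => rfl
  have htgt : (0 : ℝ) ∈ e.target := by rw [← hga]; exact e.map_source hsrc
  have hA0 : e.symm 0 = a := by rw [← hga]; exact e.left_inv hsrc
  have hAc : ContinuousAt e.symm 0 := e.continuousAt_symm htgt
  have hD : ContinuousAt (fun τ => 1 + (e.symm τ ^ 2 - (p : ℝ) ^ 2) * τ ^ 2) 0 :=
    continuousAt_const.add (((hAc.pow 2).sub continuousAt_const).mul (continuousAt_id.pow 2))
  refine ⟨e.symm, hA0, ?_⟩
  have hAt : Tendsto e.symm (𝓝 0) (𝓝 a) := by simpa only [ContinuousAt, hA0] using hAc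
  filter_upwards [hAt.eventually hgood, e.open_target.mem_nhds htgt,
    hD.eventually_const_lt (u := 0) (by simp)] with τ ⟨hpos, hwτ⟩ hτ hDτ
  have hgτ : g (e.symm τ) = τ := e.right_inv hτ
  refine ⟨hpos, ?_, hDτ, ?_⟩
  · exact (div_eq_iff hwτ).1 hgτ
  · have hd := hg' _ hpos hwτ
    rw [hgτ] at hd
    have := hd.of_local_left_inverse (e.continuousAt_symm hτ) (div_pos hDτ hpos).ne'
      ((e.open_target.eventually_mem hτ).mono fun y hy => e.right_inv hy)
    simpa using this

/-- A function with positive derivative off a point has a continuous local inverse there. -/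
theorem exists_continuous_local_inverse_of_deriv_pos {f f' : ℝ → ℝ}
    (hf : ∀ᶠ τ in 𝓝 0, HasDerivAt f (f' τ) τ) (hpos : ∀ᶠ τ in 𝓝 0, τ ≠ 0 → 0 < f' τ) :
    ∃ g : ℝ → ℝ, g (f 0) = 0 ∧ ∀ᶠ y in 𝓝 (f 0), ContinuousAt g y ∧ f (g y) = y := by
  obtain ⟨η, hη, hball⟩ := Metric.eventually_nhds_iff.1 (hf.and hpos)
  set r := η / 2 with hr
  have hr0 : 0 < r := by positivity
  have hder : ∀ τ ∈ Icc (-r) r, HasDerivAt f (f' τ) τ ∧ (τ ≠ 0 → 0 < f' τ) := fun τ hτ =>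
    hball (by rw [Real.dist_eq, sub_zero, abs_lt]; constructor <;> linarith [hτ.1, hτ.2])
  have hcont : ContinuousOn f (Icc (-r) r) := fun τ hτ =>
    (hder τ hτ).1.continuousAt.continuousWithinAt
  have hmono : StrictMonoOn f (Icc (-r) r) := by
    rw [← Icc_union_Icc_eq_Icc (neg_nonpos.2 hr0.le) hr0.le]
    refine StrictMonoOn.union (c := 0) ?_ ?_ (isGreatest_Icc (by linarith)) (isLeast_Icc hr0.le)
    · refine strictMonoOn_of_deriv_pos (convex_Icc _ _)
        (hcont.mono (Icc_subset_Icc_right hr0.le)) fun x hx => ?_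
      rw [interior_Icc] at hx
      have := hder x ⟨hx.1.le, by linarith [hx.2]⟩
      rw [this.1.deriv]
      exact this.2 hx.2.ne
    · refine strictMonoOn_of_deriv_pos (convex_Icc _ _)
        (hcont.mono (Icc_subset_Icc_left (by linarith))) fun x hx => ?_
      rw [interior_Icc] at hx
      have := hder x ⟨by linarith [hx.1], hx.2.le⟩
      rw [this.1.deriv]
      exact this.2 hx.1.ne'
  have hl : -r ∈ Icc (-r) r := left_mem_Icc.2 (by linarith)
  have hrr : r ∈ Icc (-r) r := right_mem_Icc.2 (by linarith)
  have h0 : (0 : ℝ) ∈ Icc (-r) r := ⟨by linarith, hr0.le⟩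
  have hsurj : SurjOn f (Icc (-r) r) (Icc (f (-r)) (f r)) :=
    intermediate_value_Icc (by linarith) hcont
  set g := Function.invFunOn f (Icc (-r) r) with hg
  have hgmem : MapsTo g (Icc (f (-r)) (f r)) (Icc (-r) r) := hsurj.mapsTo_invFunOn
  have hfg : ∀ y ∈ Icc (f (-r)) (f r), f (g y) = y := hsurj.rightInvOn_invFunOn
  have hgf : ∀ x ∈ Icc (-r) r, g (f x) = x := hmono.injOn.leftInvOn_invFunOn
  have hgmono : MonotoneOn g (Icc (f (-r)) (f r)) := fun y hy y' hy' hyy' => by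
    rwa [← hmono.le_iff_le (hgmem hy) (hgmem hy'), hfg y hy, hfg y' hy']
  refine ⟨g, hgf 0 h0, ?_⟩
  have hnhds : Ioo (f (-r)) (f r) ∈ 𝓝 (f 0) :=
    Ioo_mem_nhds (hmono hl h0 (by linarith)) (hmono h0 hrr hr0)
  filter_upwards [hnhds] with y hy
  have hyI := Ioo_subset_Icc_self hy
  refine ⟨?_, hfg y hyI⟩
  refine continuousAt_of_monotoneOn_of_image_mem_nhds hgmono (Icc_mem_nhds hy.1 hy.2) ?_
  have hlt : -r < g y ∧ g y < r := by
    rw [← hmono.lt_iff_lt hl (hgmem hyI), ← hmono.lt_iff_lt (hgmem hyI) hrr, hfg y hyI]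
    exact hy
  refine mem_of_superset (Icc_mem_nhds hlt.1 hlt.2) fun x hx => ⟨f x, ?_, hgf x hx⟩
  exact ⟨hmono.monotoneOn hl hx hx.1, hmono.monotoneOn hx hrr hx.2⟩

/-- The variant of `exists_continuous_local_inverse_of_deriv_pos` in which the derivative has the
sign of a nonzero constant. -/
theorem exists_continuous_local_inverse_of_mul_deriv_pos {f f' : ℝ → ℝ} {c : ℝ} (hc : c ≠ 0)
    (hf : ∀ᶠ τ in 𝓝 0, HasDerivAt f (f' τ) τ) (hpos : ∀ᶠ τ in 𝓝 0, τ ≠ 0 → 0 < c * f' τ) :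
    ∃ g : ℝ → ℝ, g (f 0) = 0 ∧ ∀ᶠ y in 𝓝 (f 0), ContinuousAt g y ∧ f (g y) = y := by
  obtain ⟨g, hg0, hg⟩ := exists_continuous_local_inverse_of_deriv_pos (f := fun τ => c * f τ)
    (hf.mono fun τ h => h.const_mul c) hpos
  have hcc : Continuous fun y : ℝ => c * y := by fun_prop
  refine ⟨fun y => g (c * y), hg0, ?_⟩
  filter_upwards [(hcc.tendsto (f 0)).eventually hg] with y hy
  exact ⟨ContinuousAt.comp (g := g) hy.1 hcc.continuousAt, mul_left_cancel₀ hc hy.2⟩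

/-- Points with a common ratio `J_p(x) / (x J_p'(x))` give real roots of `Fp`. -/
theorem Fp_eq_zero_of_ratio {p : ℕ} {x y τ : ℝ} (hx : 0 < x) (hy : 0 < y)
    (hxτ : realBesselJ p x = τ * realBesselEuler p x)
    (hyτ : realBesselJ p y = τ * realBesselEuler p y) : Fp p x ((y / x) ^ 2) = 0 := by
  have hs : ((√((y / x) ^ 2) : ℝ) : ℂ) = y / x := by
    rw [Real.sqrt_sq (div_pos hy hx).le, ofReal_div]
  have hx0 : (x : ℂ) ≠ 0 := ofReal_ne_zero.2 hx.ne'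
  have h1 := congrArg (fun t : ℝ => (t : ℂ)) hxτ
  have h2 := congrArg (fun t : ℝ => (t : ℂ)) hyτ
  simp only [ofReal_mul, ofReal_realBesselJ, ofReal_realBesselEuler] at h1 h2
  rw [Fp, hs, div_mul_cancel₀ _ hx0, h1, h2]
  field_simp
  ring

/-- a real-valued ITE trajectory accompanies any complex-valued one through an IDE. -/
theorem stmt_14 (p : ℕ) (nst : ℝ) (hnst : 0 < nst) (hnst1 : nst ≠ 1) (ε : ℝ) (hε : 0 < ε)
    (κ : ℝ → ℂ) (hcont : ContinuousOn κ (Set.Ioo (nst - ε) (nst + ε)))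
    (hF : ∀ n ∈ Set.Ioo (nst - ε) (nst + ε), Fp p (κ n) n = 0)
    (him : ∀ n ∈ Set.Ioo (nst - ε) (nst + ε), n ≠ nst → (κ n).im ≠ 0)
    (κs : ℝ) (hκs : 0 < κs) (hval : κ nst = (κs : ℂ))
    (hJ : besselJ p (κs : ℂ) = 0) (hJ' : besselJ' p (κs : ℂ) ≠ 0) :
    ∃ δ, 0 < δ ∧ δ ≤ ε ∧ ∃ κt : ℝ → ℝ,
      ContinuousOn κt (Set.Ioo (nst - δ) (nst + δ)) ∧
      (∀ n ∈ Set.Ioo (nst - δ) (nst + δ), Fp p ((κt n : ℝ) : ℂ) n = 0) ∧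
      κt nst = κs := by
  have hmem : nst ∈ Set.Ioo (nst - ε) (nst + ε) := ⟨by linarith, by linarith⟩
  set b := √nst * κs with hb
  have hb0 : 0 < b := mul_pos (Real.sqrt_pos.2 hnst) hκs
  have hja : realBesselJ p κs = 0 := by rw [realBesselJ, hJ, zero_re]
  have hwa : realBesselEuler p κs ≠ 0 := by
    rw [← ofReal_ne_zero, ofReal_realBesselEuler]
    exact mul_ne_zero (ofReal_ne_zero.2 hκs.ne') hJ'
  have hjb : realBesselJ p b = 0 := by
    have h := hF nst hmem
    rw [Fp, hval, hJ, mul_zero, zero_mul, sub_zero, ← ofReal_mul, ← hb] at h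
    simp only [mul_eq_zero, ofReal_eq_zero, hκs.ne', hJ', false_or] at h
    rw [realBesselJ, h, zero_re]
  have hab : κs ^ 2 ≠ b ^ 2 := by
    rw [hb, mul_pow, Real.sq_sqrt hnst.le]
    intro h
    exact hnst1 (mul_right_cancel₀ (pow_ne_zero 2 hκs.ne') (by rw [one_mul]; exact h.symm))
  obtain ⟨A, hA0, hA⟩ := exists_realBessel_ratio_inverse hκs hja hwa
  obtain ⟨B, hB0, hB⟩ := exists_realBessel_ratio_inverse hb0 hjb
    (realBesselEuler_ne_zero hκs hb0 hwa hjb)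
  have hf0 : (B 0 / A 0) ^ 2 = nst := by
    rw [hA0, hB0, hb, mul_div_cancel_right₀ _ hκs.ne', Real.sq_sqrt hnst.le]
  have hAc : ContinuousAt A 0 := hA.self_of_nhds.2.2.2.continuousAt
  have hBc : ContinuousAt B 0 := hB.self_of_nhds.2.2.2.continuousAt
  have hsign : ∀ᶠ τ in 𝓝 0, 0 < (κs ^ 2 - b ^ 2) * (A τ ^ 2 - B τ ^ 2) := by
    have hc : ContinuousAt (fun τ => (κs ^ 2 - b ^ 2) * (A τ ^ 2 - B τ ^ 2)) 0 :=
      continuousAt_const.mul ((hAc.pow 2).sub (hBc.pow 2))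
    refine hc.eventually_const_lt ?_
    simp only [hA0, hB0]
    exact mul_self_pos.2 (sub_ne_zero.2 hab)
  obtain ⟨g, hg0, hg⟩ := exists_continuous_local_inverse_of_mul_deriv_pos
    (f := fun τ => (B τ / A τ) ^ 2)
    (f' := fun τ => 2 * (B τ / A τ) ^ 2 * (τ ^ 2 * (A τ ^ 2 - B τ ^ 2)) /
      ((1 + (A τ ^ 2 - (p : ℝ) ^ 2) * τ ^ 2) * (1 + (B τ ^ 2 - (p : ℝ) ^ 2) * τ ^ 2)))
    (sub_ne_zero.2 hab)
    (by
      filter_upwards [hA, hB] with τ ⟨hA1, _, hA3, hA4⟩ ⟨hB1, _, hB3, hB4⟩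
      refine ((hB4.fun_div hA4 hA1.ne').fun_pow 2).congr_deriv ?_
      have hdiff : τ ^ 2 * (A τ ^ 2 - B τ ^ 2) = (1 + (A τ ^ 2 - (p : ℝ) ^ 2) * τ ^ 2) -
        (1 + (B τ ^ 2 - (p : ℝ) ^ 2) * τ ^ 2) := by ring
      rw [hdiff]
      generalize 1 + (A τ ^ 2 - (p : ℝ) ^ 2) * τ ^ 2 = D at *
      generalize 1 + (B τ ^ 2 - (p : ℝ) ^ 2) * τ ^ 2 = E at *
      have := hA1.ne'
      push_cast
      rw [pow_one]
      field_simp)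
    (by
      filter_upwards [hA, hB, hsign] with τ ⟨hA1, _, hA3, _⟩ ⟨hB1, _, hB3, _⟩ hs hτ
      have hq : 0 < 2 * (B τ / A τ) ^ 2 * τ ^ 2 /
        ((1 + (A τ ^ 2 - (p : ℝ) ^ 2) * τ ^ 2) * (1 + (B τ ^ 2 - (p : ℝ) ^ 2) * τ ^ 2)) := by
        positivity
      refine (mul_pos hq hs).trans_eq ?_
      ring)
  simp only [hf0] at hg0 hg
  have hgt : Tendsto g (𝓝 nst) (𝓝 0) := by
    simpa only [ContinuousAt, hg0] using hg.self_of_nhds.1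
  obtain ⟨δ, hδ, hball⟩ := Metric.eventually_nhds_iff.1
    (hg.and (hgt.eventually (hA.and hB)))
  have hgood := fun (n : ℝ) (hn : n ∈ Set.Ioo (nst - min δ ε) (nst + min δ ε)) =>
    @hball n (by
      rw [← Real.ball_eq_Ioo] at hn
      exact (Metric.mem_ball.1 hn).trans_le (min_le_left _ _))
  refine ⟨min δ ε, lt_min hδ hε, min_le_right _ _, fun n => A (g n), fun n hn => ?_,
    fun n hn => ?_, by simp only [hg0, hA0]⟩
  · obtain ⟨⟨hgc, -⟩, hAn, -⟩ := hgood n hn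
    exact (ContinuousAt.comp (g := A) hAn.2.2.2.continuousAt hgc).continuousWithinAt
  · obtain ⟨⟨-, hfn⟩, hAn, hBn⟩ := hgood n hn
    have h := Fp_eq_zero_of_ratio hAn.1 hBn.1 hAn.2.1 hBn.2.1
    rwa [hfn] at h
end
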